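/- Let (v_h, w_h) be piecewise polynomials of degree ≤ k (vector- and scalar-valued respectively) on an element K. Then for any integer k ≥ 0 there is a constant C independent of h such that ‖σ^{−1}(σ² v_h − Π_k^o(σ² v_h))‖_{L²(K)} ≤ C h ‖v_h‖_{L²(K)} and ‖σ^{−1}(σ² v_h − Π_V(σ² v_h))‖_{L²(K)} ≤ C h (‖v_h‖_{L²(K)} + ‖w_h‖_{L²(K)}), where Π_V(σ² v_h) denotes the first component of the HDG projection of the pair (σ² v_h, −σ² w_h). -/

import Mathlib

open MeasureTheory ENNReal Metric Set
open scoped RealInnerProductSpace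

noncomputable section

local notation "E2" => EuclideanSpace ℝ (Fin 2)

def sigw (x₀ : E2) (h : ℝ) (x : E2) : ℝ := Real.sqrt (‖x - x₀‖ ^ 2 + h ^ 2)

def sobSemi {F : Type*} [NormedAddCommGroup F] [NormedSpace ℝ F]
    (j : ℕ) (p : ℝ≥0∞) (K : Set E2) (f : E2 → F) : ℝ≥0∞ :=
  eLpNorm (fun x => ‖iteratedFDeriv ℝ j f x‖) p (volume.restrict K)

def IsPolyOn (k : ℕ) (K : Set E2) (f : E2 → ℝ) : Prop :=
  ∃ P : MvPolynomial (Fin 2) ℝ, P.totalDegree ≤ k ∧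
    ∀ x ∈ K, f x = MvPolynomial.eval (fun i => x i) P

def IsVPolyOn (k : ℕ) (K : Set E2) (f : E2 → E2) : Prop :=
  ∀ i, IsPolyOn k K fun x => f x i

/-- The HDG projection system (2.5) on a triangle `K ⊂ ℝ²` with faces `Fc`,
outward unit normals `n` and facewise constant stabilization `τ`. -/
def ProjSys2 (k : ℕ) (K : Set E2) (Fc : Fin 3 → Set E2) (n : Fin 3 → E2)
    (τ : Fin 3 → ℝ) (q : E2 → E2) (u : E2 → ℝ) (Pq : E2 → E2) (Pu : E2 → ℝ) : Prop :=
  IsVPolyOn k K Pq ∧ IsPolyOn k K Pu ∧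
  (1 ≤ k → ∀ v, IsVPolyOn (k-1) K v → ∫ x in K, ⟪Pq x - q x, v x⟫ = 0) ∧
  (1 ≤ k → ∀ w, IsPolyOn (k-1) K w → ∫ x in K, (Pu x - u x) * w x = 0) ∧
  (∀ i, ∀ μ, IsPolyOn k (Fc i) μ →
    ∫ x, (⟪Pq x - q x, n i⟫ + τ i * (Pu x - u x)) * μ x
      ∂((μH[1]).restrict (Fc i)) = 0)

/-- `K` is a triangle of a quasi-uniform mesh of size `h` (diameter at most `h`,
inscribed ball of radius at least `c₀ h`), with faces `Fc` and outward unit normals. -/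
def GoodTriangle (h c₀ : ℝ) (K : Set E2) (Fc : Fin 3 → Set E2) (n : Fin 3 → E2) : Prop :=
  (∃ vv : Fin 3 → E2, AffineIndependent ℝ vv ∧ K = convexHull ℝ (range vv) ∧
    ∀ i, Fc i = convexHull ℝ (vv '' {j | j ≠ i})) ∧
  Metric.diam K ≤ h ∧ (∃ z : E2, ball z (c₀ * h) ⊆ K) ∧
  (∀ i, ‖n i‖ = 1 ∧ ∀ x ∈ Fc i, ∀ y ∈ K, ⟪n i, y - x⟫ ≤ 0)

local notation "P2" => MvPolynomial (Fin 2) ℝ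

/-! ### Degree bounds for bivariate polynomials -/

theorem totalDegree_pderiv_le (i : Fin 2) (k : ℕ) (p : P2) (hp : p.totalDegree ≤ k) :
    (MvPolynomial.pderiv i p).totalDegree ≤ k - 1 := by
  rw [← p.support_sum_monomial_coeff, map_sum]
  refine MvPolynomial.totalDegree_finsetSum_le fun m hm => ?_
  rw [MvPolynomial.pderiv_monomial]
  have hdeg : (m.sum fun _ e => e) ≤ k := (MvPolynomial.le_totalDegree hm).trans hp
  by_cases h0 : m i = 0
  · simp [h0]
  refine (MvPolynomial.totalDegree_monomial_le _ _).trans ?_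
  rw [Finsupp.sum_fintype _ _ (fun _ => rfl)] at hdeg ⊢
  fin_cases i <;> simp_all [Fin.sum_univ_two, Finsupp.single_apply] <;> omega

theorem euler_remainder_totalDegree (k : ℕ) (p : P2) (hp : p.totalDegree ≤ k) :
    (∑ i, MvPolynomial.X i * MvPolynomial.pderiv i p - (k : ℝ) • p).totalDegree ≤ k - 1 := by
  have key : ∑ i, MvPolynomial.X i * MvPolynomial.pderiv i p - (k : ℝ) • p =
      ∑ m ∈ p.support, (((m.sum fun _ e => e : ℕ) : ℝ) - k) •
        MvPolynomial.monomial m (p.coeff m) := by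
    conv_lhs => rw [← p.support_sum_monomial_coeff]
    simp only [map_sum, Finset.mul_sum, Finset.smul_sum]
    rw [Finset.sum_comm, ← Finset.sum_sub_distrib]
    refine Finset.sum_congr rfl fun m _ => ?_
    simp only [MvPolynomial.X_mul_pderiv_monomial, Fin.sum_univ_two]
    rw [Finsupp.sum_fintype _ _ (fun _ => rfl), Fin.sum_univ_two, sub_smul]
    simp only [Nat.cast_add, add_smul, Nat.cast_smul_eq_nsmul]
  rw [key]
  refine MvPolynomial.totalDegree_finsetSum_le fun m hm => ?_
  have hdeg : (m.sum fun _ e => e) ≤ k := (MvPolynomial.le_totalDegree hm).trans hp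
  rcases hdeg.eq_or_lt with h | h
  · simp [h]
  · exact (MvPolynomial.totalDegree_smul_le _ _).trans
      ((MvPolynomial.totalDegree_monomial_le _ _).trans (Nat.le_sub_one_of_lt h))

theorem totalDegree_bind₁_le (g : Fin 2 → P2) (hg : ∀ i, (g i).totalDegree ≤ 1) (p : P2) :
    (MvPolynomial.bind₁ g p).totalDegree ≤ p.totalDegree := by
  conv_lhs => rw [← p.support_sum_monomial_coeff, map_sum]
  refine MvPolynomial.totalDegree_finsetSum_le fun m hm => ?_
  have hdeg : (m.sum fun _ e => e) ≤ p.totalDegree := MvPolynomial.le_totalDegree hm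
  rw [MvPolynomial.bind₁_monomial]
  rw [Finsupp.sum_fintype _ _ (fun _ => rfl)] at hdeg
  refine (MvPolynomial.totalDegree_mul _ _).trans ?_
  rw [MvPolynomial.totalDegree_C, zero_add]
  refine (MvPolynomial.totalDegree_finsetProd _ _).trans ?_
  refine (Finset.sum_le_sum (g := fun i => m i) fun i _ => ?_).trans
    ((Finset.sum_le_univ_sum_of_nonneg fun _ => Nat.zero_le _).trans hdeg)
  exact (MvPolynomial.totalDegree_pow _ _).trans
    ((Nat.mul_le_mul_left _ (hg i)).trans (by simp))

/-! ### Integration over the reference triangle and its edges -/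

/-- Evaluation of a bivariate polynomial at a point of `ℝ × ℝ`. -/
def evPair (z : ℝ × ℝ) (p : P2) : ℝ := MvPolynomial.eval ![z.1, z.2] p

theorem evPair_add (z : ℝ × ℝ) (p q : P2) : evPair z (p + q) = evPair z p + evPair z q := by
  simp [evPair]

theorem evPair_sub (z : ℝ × ℝ) (p q : P2) : evPair z (p - q) = evPair z p - evPair z q := by
  simp [evPair]

theorem evPair_mul (z : ℝ × ℝ) (p q : P2) : evPair z (p * q) = evPair z p * evPair z q := by
  simp [evPair]

theorem evPair_neg (z : ℝ × ℝ) (p : P2) : evPair z (-p) = -evPair z p := by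
  simp [evPair]

theorem evPair_smul (z : ℝ × ℝ) (c : ℝ) (p : P2) : evPair z (c • p) = c * evPair z p := by
  simp [evPair, MvPolynomial.smul_eval]

theorem continuous_evPair (p : P2) : Continuous fun z => evPair z p := by
  unfold evPair
  refine (MvPolynomial.continuous_eval p).comp (continuous_pi fun i => ?_)
  fin_cases i
  · exact continuous_fst
  · exact continuous_snd

/-- The reference triangle. -/
def refTri : Set (ℝ × ℝ) := {z | 0 ≤ z.1 ∧ 0 ≤ z.2 ∧ z.1 + z.2 ≤ 1}

theorem isCompact_refTri : IsCompact refTri := by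
  refine (isCompact_Icc (a := ((0 : ℝ), (0 : ℝ))) (b := (1, 1))).of_isClosed_subset ?_ ?_
  · exact (isClosed_le continuous_const continuous_fst).inter
      ((isClosed_le continuous_const continuous_snd).inter
        (isClosed_le (continuous_fst.add continuous_snd) continuous_const))
  · rintro ⟨x, y⟩ ⟨hx, hy, hxy⟩
    simp only [Prod.mk_zero_zero] at *
    exact ⟨⟨hx, hy⟩, ⟨by simp only at *; linarith, by simp only at *; linarith⟩⟩

theorem measurableSet_refTri : MeasurableSet refTri := isCompact_refTri.isClosed.measurableSet

theorem integrableOn_evPair (p : P2) : IntegrableOn (fun z => evPair z p) refTri :=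
  (continuous_evPair p).continuousOn.integrableOn_compact isCompact_refTri

/-- Integration of polynomials over the reference triangle. -/
def triInt : P2 →ₗ[ℝ] ℝ where
  toFun p := ∫ z in refTri, evPair z p
  map_add' p q := by
    simp only [evPair_add]
    exact integral_add (integrableOn_evPair p) (integrableOn_evPair q)
  map_smul' c p := by
    simp only [evPair_smul, RingHom.id_apply, smul_eq_mul]
    exact integral_const_mul _ _

/-- Parametrization of the edge opposite to the vertex `i` of the reference triangle, with
vertices `(0, 0)`, `(1, 0)` and `(0, 1)`. -/
def edgePt : Fin 3 → ℝ → ℝ × ℝ := ![fun t => (1 - t, t), fun t => (0, t), fun t => (t, 0)]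

theorem continuous_edgePt (i : Fin 3) : Continuous (edgePt i) := by
  fin_cases i
  · exact (continuous_const.sub continuous_id).prodMk continuous_id
  · exact continuous_const.prodMk continuous_id
  · exact continuous_id.prodMk continuous_const

theorem intervalIntegrable_edge (i : Fin 3) (p : P2) :
    IntervalIntegrable (fun t => evPair (edgePt i t) p) volume 0 1 :=
  ((continuous_evPair p).comp (continuous_edgePt i)).intervalIntegrable _ _

/-- Integration of polynomials over the edges of the reference triangle. -/
def edgeInt (i : Fin 3) : P2 →ₗ[ℝ] ℝ where
  toFun p := ∫ t in (0 : ℝ)..1, evPair (edgePt i t) p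
  map_add' p q := by
    simp only [evPair_add]
    exact intervalIntegral.integral_add (intervalIntegrable_edge i p) (intervalIntegrable_edge i q)
  map_smul' c p := by
    simp only [evPair_smul, RingHom.id_apply, smul_eq_mul]
    exact intervalIntegral.integral_const_mul _ _

theorem edgeInt_sq_nonneg (i : Fin 3) (p : P2) : 0 ≤ edgeInt i (p * p) := by
  refine intervalIntegral.integral_nonneg zero_le_one fun t _ => ?_
  rw [evPair_mul]
  exact mul_self_nonneg _

theorem edgeInt_congr (i : Fin 3) (p q : P2)
    (h : ∀ t, evPair (edgePt i t) p = evPair (edgePt i t) q) : edgeInt i p = edgeInt i q :=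
  intervalIntegral.integral_congr fun t _ => h t

theorem triInt_sq_eq_zero (p : P2) (h : triInt (p * p) = 0) : p = 0 := by
  have h1 : (fun z => evPair z (p * p)) =ᵐ[volume.restrict refTri] 0 := by
    refine (setIntegral_eq_zero_iff_of_nonneg_ae (Filter.Eventually.of_forall fun z => ?_)
      (integrableOn_evPair _)).1 h
    rw [evPair_mul]
    exact mul_self_nonneg _
  set U : Set (ℝ × ℝ) := Ioo 0 (1 / 2) ×ˢ Ioo 0 (1 / 2) with hU
  have hUo : IsOpen U := isOpen_Ioo.prod isOpen_Ioo
  have hUT : U ⊆ refTri := by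
    rintro ⟨x, y⟩ ⟨⟨hx, hx'⟩, ⟨hy, hy'⟩⟩
    simp only at *
    exact ⟨hx.le, hy.le, by simp only; linarith⟩
  have h2 : EqOn (fun z => evPair z (p * p)) 0 U :=
    Measure.eqOn_open_of_ae_eq (ae_mono (Measure.restrict_mono hUT le_rfl) h1) hUo
      (continuous_evPair _).continuousOn continuousOn_const
  refine MvPolynomial.funext_set (fun _ => Ioo 0 (1 / 2))
    (fun _ => Set.Ioo_infinite (by norm_num)) fun x hx => ?_
  have h3 := h2 (x := (x 0, x 1)) ⟨hx 0 (mem_univ _), hx 1 (mem_univ _)⟩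
  have h4 : ![x 0, x 1] = x := by ext i; fin_cases i <;> rfl
  simp only [evPair_mul, Pi.zero_apply, mul_self_eq_zero] at h3
  rw [evPair, h4] at h3
  simpa using h3

theorem hasDerivAt_evPair_fst (p : P2) (x y : ℝ) :
    HasDerivAt (fun s => evPair (s, y) p) (evPair (x, y) (MvPolynomial.pderiv 0 p)) x := by
  induction p using MvPolynomial.induction_on with
  | C a => simpa [evPair] using hasDerivAt_const x a
  | add p q hp hq => simpa only [evPair_add, map_add] using hp.fun_add hq
  | mul_X p i hp =>
    have hX : HasDerivAt (fun s => evPair (s, y) (MvPolynomial.X i))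
        (evPair (x, y) (MvPolynomial.pderiv 0 (MvPolynomial.X i))) x := by
      fin_cases i
      · simpa [evPair] using hasDerivAt_id' x
      · simpa [evPair] using hasDerivAt_const x y
    have := hp.fun_mul hX
    simp only [Derivation.leibniz, smul_eq_mul, evPair_add, evPair_mul]
    exact this.congr_deriv (by ring)

theorem hasDerivAt_evPair_snd (p : P2) (x y : ℝ) :
    HasDerivAt (fun s => evPair (x, s) p) (evPair (x, y) (MvPolynomial.pderiv 1 p)) y := by
  induction p using MvPolynomial.induction_on with
  | C a => simpa [evPair] using hasDerivAt_const y a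
  | add p q hp hq => simpa only [evPair_add, map_add] using hp.fun_add hq
  | mul_X p i hp =>
    have hX : HasDerivAt (fun s => evPair (x, s) (MvPolynomial.X i))
        (evPair (x, y) (MvPolynomial.pderiv 1 (MvPolynomial.X i))) y := by
      fin_cases i
      · simpa [evPair] using hasDerivAt_const y x
      · simpa [evPair] using hasDerivAt_id' y
    have := hp.fun_mul hX
    simp only [Derivation.leibniz, smul_eq_mul, evPair_add, evPair_mul]
    exact this.congr_deriv (by ring)

theorem setIntegral_refTri (f : ℝ × ℝ → ℝ) (hf : Continuous f) :
    ∫ z in refTri, f z = ∫ x in (0 : ℝ)..1, ∫ y in (0 : ℝ)..(1 - x), f (x, y) := by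
  have hint : Integrable (refTri.indicator f) :=
    (integrable_indicator_iff measurableSet_refTri).2
      (hf.continuousOn.integrableOn_compact isCompact_refTri)
  rw [← integral_indicator measurableSet_refTri, Measure.volume_eq_prod,
    integral_prod _ (by rwa [← Measure.volume_eq_prod])]
  rw [intervalIntegral.integral_of_le zero_le_one, ← integral_Icc_eq_integral_Ioc,
    ← integral_indicator measurableSet_Icc]
  refine integral_congr_ae (Filter.Eventually.of_forall fun x => ?_)
  by_cases hx : x ∈ Icc (0 : ℝ) 1
  · simp only [indicator_of_mem hx]
    rw [intervalIntegral.integral_of_le (by linarith [hx.2]), ← integral_Icc_eq_integral_Ioc,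
      ← integral_indicator measurableSet_Icc]
    refine integral_congr_ae (Filter.Eventually.of_forall fun y => ?_)
    have hmem : (x, y) ∈ refTri ↔ y ∈ Icc 0 (1 - x) :=
      ⟨fun ⟨_, h2, h3⟩ => ⟨h2, le_sub_iff_add_le'.2 h3⟩,
        fun ⟨h2, h3⟩ => ⟨hx.1, h2, le_sub_iff_add_le'.1 h3⟩⟩
    change refTri.indicator f (x, y) = (Icc 0 (1 - x)).indicator (fun y => f (x, y)) y
    by_cases hy : y ∈ Icc 0 (1 - x)
    · rw [indicator_of_mem hy, indicator_of_mem (hmem.2 hy)]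
    · rw [indicator_of_notMem hy, indicator_of_notMem (mt hmem.1 hy)]
  · simp only [indicator_of_notMem hx]
    rw [← integral_zero ℝ ℝ (μ := volume)]
    refine integral_congr_ae (Filter.Eventually.of_forall fun y => ?_)
    refine indicator_of_notMem (fun h => hx ?_) _
    obtain ⟨h1, h2, h3⟩ := h
    simp only at *
    exact ⟨h1, by linarith⟩

theorem setIntegral_refTri_swap (f : ℝ × ℝ → ℝ) (hf : Continuous f) :
    ∫ z in refTri, f z = ∫ y in (0 : ℝ)..1, ∫ x in (0 : ℝ)..(1 - y), f (x, y) := by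
  refine Eq.trans ?_ (setIntegral_refTri (fun z => f z.swap) (hf.comp continuous_swap))
  have hpre : Prod.swap ⁻¹' refTri = refTri := by
    ext ⟨x, y⟩
    simp only [refTri, mem_preimage, mem_ofPred_eq, Prod.swap, add_comm y x]
    tauto
  have := (Measure.measurePreserving_swap (μ := (volume : Measure ℝ))
    (ν := (volume : Measure ℝ))).setIntegral_preimage_emb
      MeasurableEquiv.prodComm.measurableEmbedding f refTri
  rw [hpre] at this
  exact this.symm

theorem triInt_pderiv_zero (p : P2) :
    triInt (MvPolynomial.pderiv 0 p) = edgeInt 0 p - edgeInt 1 p := by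
  change ∫ z in refTri, _ = (∫ t in (0 : ℝ)..1, _) - ∫ t in (0 : ℝ)..1, _
  rw [setIntegral_refTri_swap _ (continuous_evPair _), ← intervalIntegral.integral_sub
    (intervalIntegrable_edge 0 p) (intervalIntegrable_edge 1 p)]
  refine intervalIntegral.integral_congr fun y _ => ?_
  exact intervalIntegral.integral_eq_sub_of_hasDerivAt
    (fun x _ => hasDerivAt_evPair_fst p x y)
    (((continuous_evPair _).comp (by fun_prop)).intervalIntegrable _ _)

theorem triInt_pderiv_one (p : P2) :
    triInt (MvPolynomial.pderiv 1 p) = edgeInt 0 p - edgeInt 2 p := by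
  have h0 : edgeInt 0 p = ∫ t in (0 : ℝ)..1, evPair (t, 1 - t) p := by
    have := intervalIntegral.integral_comp_sub_left (a := 0) (b := 1)
      (fun t => evPair (t, 1 - t) p) 1
    rw [sub_self, sub_zero] at this
    rw [← this]
    refine intervalIntegral.integral_congr fun t _ => ?_
    exact congrArg (fun r : ℝ => evPair (1 - t, r) p) (by ring)
  rw [h0]
  change ∫ z in refTri, _ = _ - ∫ t in (0 : ℝ)..1, _
  have hc : Continuous fun t : ℝ => evPair (t, 1 - t) p :=
    (continuous_evPair p).comp (continuous_id.prodMk (continuous_const.sub continuous_id))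
  rw [setIntegral_refTri _ (continuous_evPair _), ← intervalIntegral.integral_sub
    (hc.intervalIntegrable _ _) (intervalIntegrable_edge 2 p)]
  refine intervalIntegral.integral_congr fun x _ => ?_
  exact intervalIntegral.integral_eq_sub_of_hasDerivAt
    (fun y _ => hasDerivAt_evPair_snd p x y)
    (((continuous_evPair _).comp (by fun_prop)).intervalIntegrable _ _)

/-! ### Unisolvence of the HDG projection on the reference triangle -/

theorem triInt_mul_pderiv_eq_zero (k : ℕ) (s : P2)
    (hs : ∀ v : P2, v.totalDegree + 1 ≤ k → triInt (s * v) = 0) (p : P2)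
    (hp : p.totalDegree ≤ k) (i : Fin 2) : triInt (s * MvPolynomial.pderiv i p) = 0 := by
  rcases Nat.eq_zero_or_pos k with rfl | hk
  · rw [MvPolynomial.totalDegree_eq_zero_iff_eq_C.1 (Nat.le_zero.1 hp)]
    simp
  · exact hs _ (by have := totalDegree_pderiv_le i k p hp; omega)

theorem triInt_mul_euler_eq_zero (k : ℕ) (s : P2)
    (hs : ∀ v : P2, v.totalDegree + 1 ≤ k → triInt (s * v) = 0) (p : P2)
    (hp : p.totalDegree ≤ k) :
    triInt (s * (MvPolynomial.X 0 * MvPolynomial.pderiv 0 p +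
      MvPolynomial.X 1 * MvPolynomial.pderiv 1 p - (k : ℝ) • p)) = 0 := by
  rcases Nat.eq_zero_or_pos k with rfl | hk
  · rw [MvPolynomial.totalDegree_eq_zero_iff_eq_C.1 (Nat.le_zero.1 hp)]
    simp
  · have := euler_remainder_totalDegree k p hp
    rw [Fin.sum_univ_two] at this
    exact hs _ (by omega)

theorem edgeInt_moment_identity (k : ℕ) (s : P2) (hdeg : s.totalDegree ≤ k)
    (hs : ∀ v : P2, v.totalDegree + 1 ≤ k → triInt (s * v) = 0) (a b : ℝ) :
    (2 + 2 * k) * triInt (s * s) =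
      edgeInt 0 ((MvPolynomial.X 0 + MvPolynomial.X 1 - MvPolynomial.C (a + b)) * (s * s)) -
      edgeInt 1 ((MvPolynomial.X 0 - MvPolynomial.C a) * (s * s)) -
      edgeInt 2 ((MvPolynomial.X 1 - MvPolynomial.C b) * (s * s)) := by
  have h0 := triInt_pderiv_zero ((MvPolynomial.X 0 - MvPolynomial.C a) * (s * s))
  have h1 := triInt_pderiv_one ((MvPolynomial.X 1 - MvPolynomial.C b) * (s * s))
  have hsum : (MvPolynomial.X 0 + MvPolynomial.X 1 - MvPolynomial.C (a + b)) * (s * s) =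
      (MvPolynomial.X 0 - MvPolynomial.C a) * (s * s) +
      (MvPolynomial.X 1 - MvPolynomial.C b) * (s * s) := by
    rw [MvPolynomial.C_add]; ring
  have hE := triInt_mul_euler_eq_zero k s hs s hdeg
  have hd0 := triInt_mul_pderiv_eq_zero k s hs s hdeg 0
  have hd1 := triInt_mul_pderiv_eq_zero k s hs s hdeg 1
  have hdiv : MvPolynomial.pderiv 0 ((MvPolynomial.X 0 - MvPolynomial.C a) * (s * s)) +
      MvPolynomial.pderiv 1 ((MvPolynomial.X 1 - MvPolynomial.C b) * (s * s)) =
      (2 + 2 * k : ℝ) • (s * s) + (2 : ℝ) • (s * (MvPolynomial.X 0 * MvPolynomial.pderiv 0 s +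
        MvPolynomial.X 1 * MvPolynomial.pderiv 1 s - (k : ℝ) • s)) -
      (2 * a) • (s * MvPolynomial.pderiv 0 s) - (2 * b) • (s * MvPolynomial.pderiv 1 s) := by
    simp only [Derivation.leibniz, map_sub, MvPolynomial.pderiv_X_self, MvPolynomial.pderiv_C,
      smul_eq_mul, MvPolynomial.smul_eq_C_mul, MvPolynomial.C_add, MvPolynomial.C_mul, map_ofNat]
    ring
  have := congrArg triInt hdiv
  simp only [map_add, map_sub, map_smul, smul_eq_mul, hE, hd0, hd1] at this
  rw [hsum, map_add]
  linarith

theorem edgeInt_sq_eq_triInt (k : ℕ) (s : P2) (hdeg : s.totalDegree ≤ k)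
    (hs : ∀ v : P2, v.totalDegree + 1 ≤ k → triInt (s * v) = 0) (i : Fin 3) :
    (2 + 2 * k) * triInt (s * s) = edgeInt i (s * s) := by
  have hzero : ∀ (j : Fin 3) (l : P2), (∀ t, evPair (edgePt j t) l = 0) →
      edgeInt j (l * (s * s)) = 0 := fun j l hl => by
    rw [edgeInt_congr j _ 0 fun t => by rw [evPair_mul, hl t]; simp [evPair], map_zero]
  have hone : ∀ (j : Fin 3) (l : P2) (c : ℝ), (∀ t, evPair (edgePt j t) l = c) →
      edgeInt j (l * (s * s)) = c * edgeInt j (s * s) := fun j l c hl => by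
    rw [edgeInt_congr j _ (c • (s * s)) fun t => by rw [evPair_mul, hl t, evPair_smul], map_smul,
      smul_eq_mul]
  fin_cases i
  · rw [edgeInt_moment_identity k s hdeg hs 0 0, hone 0 _ 1, hzero 1, hzero 2]
    · simp
    all_goals intro t; simp [evPair, edgePt]
  · rw [edgeInt_moment_identity k s hdeg hs 1 0, hzero 0, hone 1 _ (-1), hzero 2]
    · simp
    all_goals intro t; simp [evPair, edgePt]
  · rw [edgeInt_moment_identity k s hdeg hs 0 1, hzero 0, hzero 1, hone 2 _ (-1)]
    · simp
    all_goals intro t; simp [evPair, edgePt]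

/-- The normal component, up to scaling, of a vector polynomial on an edge of the reference
triangle. -/
def refNormal (i : Fin 3) (x : Fin 3 → P2) : P2 := ![x 0 + x 1, -x 0, -x 1] i

theorem refNormal_sub (i : Fin 3) (x y : Fin 3 → P2) :
    refNormal i (x - y) = refNormal i x - refNormal i y := by
  fin_cases i <;> simp [refNormal] <;> ring

/-- The only polynomial solution of the homogeneous HDG projection system on the reference
triangle is zero. Here `x 0`, `x 1` are the components of the vector unknown and `x 2` is the
scalar unknown. -/
theorem hdg_unisolvent (k : ℕ) (τ : Fin 3 → ℝ) (hτ : ∀ i, 0 < τ i) (x : Fin 3 → P2)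
    (hdeg : ∀ j, (x j).totalDegree ≤ k)
    (hint : ∀ j, ∀ v : P2, v.totalDegree + 1 ≤ k → triInt (x j * v) = 0)
    (hedge : ∀ i, ∀ μ : P2, μ.totalDegree ≤ k →
      edgeInt i (refNormal i x * μ) + τ i * edgeInt i (x 2 * μ) = 0) : x = 0 := by
  have hgauss : edgeInt 0 (refNormal 0 x * x 2) + edgeInt 1 (refNormal 1 x * x 2) +
      edgeInt 2 (refNormal 2 x * x 2) = 0 := by
    have h0 := triInt_pderiv_zero (x 0 * x 2)
    have h1 := triInt_pderiv_one (x 1 * x 2)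
    simp only [Derivation.leibniz, smul_eq_mul, map_add,
      triInt_mul_pderiv_eq_zero k _ (hint _) _ (hdeg _)] at h0 h1
    simp only [refNormal, Matrix.cons_val_zero, Matrix.cons_val_one, Matrix.cons_val, add_mul,
      neg_mul, map_add, map_neg]
    linarith
  have hs0 := hedge 0 _ (hdeg 2)
  have hs1 := hedge 1 _ (hdeg 2)
  have hs2 := hedge 2 _ (hdeg 2)
  have hx2 : x 2 = 0 := by
    refine triInt_sq_eq_zero _ ?_
    have e := edgeInt_sq_eq_triInt k _ (hdeg 2) (hint 2)
    have p0 := mul_nonneg (hτ 0).le (edgeInt_sq_nonneg 0 (x 2))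
    have p1 := mul_nonneg (hτ 1).le (edgeInt_sq_nonneg 1 (x 2))
    have p2 := mul_nonneg (hτ 2).le (edgeInt_sq_nonneg 2 (x 2))
    have hz : τ 0 * edgeInt 0 (x 2 * x 2) = 0 := by linarith
    have hz' := (mul_eq_zero.1 hz).resolve_left (hτ 0).ne'
    rw [← e 0] at hz'
    exact (mul_eq_zero.1 hz').resolve_left (by positivity)
  have hx0 : x 0 = 0 := by
    refine triInt_sq_eq_zero _ ?_
    have e := edgeInt_sq_eq_triInt k _ (hdeg 0) (hint 0) 1
    have := hedge 1 _ (hdeg 0)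
    simp only [hx2, refNormal, Matrix.cons_val_one, Matrix.cons_val_zero, zero_mul, map_zero,
      mul_zero, add_zero, neg_mul, map_neg, neg_eq_zero] at this
    rw [this] at e
    exact (mul_eq_zero.1 e).resolve_left (by positivity)
  have hx1 : x 1 = 0 := by
    refine triInt_sq_eq_zero _ ?_
    have e := edgeInt_sq_eq_triInt k _ (hdeg 1) (hint 1) 2
    have := hedge 2 _ (hdeg 1)
    simp only [hx2, refNormal, Matrix.cons_val, zero_mul, map_zero,
      mul_zero, add_zero, neg_mul, map_neg, neg_eq_zero] at this
    rw [this] at e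
    exact (mul_eq_zero.1 e).resolve_left (by positivity)
  ext1 j
  fin_cases j
  · exact hx0
  · exact hx1
  · exact hx2

/-! ### Stability of the HDG projection on the reference triangle -/

/-- A family of parameter-dependent homogeneous linear constraints on a finite-dimensional space,
whose only solution with `B x x = 0` is zero, controls any quadratic form by `B`, uniformly for
parameters in a compact set. -/
theorem exists_uniform_quadratic_bound {V ι : Type*} [AddCommGroup V] [Module ℝ V]
    [FiniteDimensional ℝ V] (A B : V →ₗ[ℝ] V →ₗ[ℝ] ℝ) (hB : ∀ x, 0 ≤ B x x)
    (S : Set (Fin 3 → ℝ)) (hS : IsCompact S) (L M : ι → V →ₗ[ℝ] ℝ) (r : ι → Fin 3)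
    (huniq : ∀ τ ∈ S, ∀ x, (∀ c, L c x + τ (r c) * M c x = 0) → B x x = 0 → x = 0) :
    ∃ C : ℝ, 0 < C ∧ ∀ τ ∈ S, ∀ x, (∀ c, L c x + τ (r c) * M c x = 0) → A x x ≤ C * B x x := by
  let e := (Module.finBasis ℝ V).equivFun
  have hlin : ∀ F : V →ₗ[ℝ] ℝ, Continuous fun y => F (e.symm y) := fun F =>
    (F ∘ₗ e.symm.toLinearMap).continuous_of_finiteDimensional
  have hquad : ∀ Q : V →ₗ[ℝ] V →ₗ[ℝ] ℝ, Continuous fun y => Q (e.symm y) (e.symm y) := by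
    intro Q
    have hexp : (fun y => Q (e.symm y) (e.symm y)) =
        fun y => ∑ i, y i * Q (Module.finBasis ℝ V i) (e.symm y) := by
      funext y
      conv_lhs => enter [1]; rw [Module.Basis.equivFun_symm_apply]
      simp [LinearMap.sum_apply]
    rw [hexp]
    exact continuous_finsetSum _ fun i _ => (continuous_apply i).mul (hlin _)
  let G : Set ((Fin 3 → ℝ) × (Fin (Module.finrank ℝ V) → ℝ)) :=
    (S ×ˢ Metric.sphere 0 1) ∩
      {z | ∀ c, L c (e.symm z.2) + z.1 (r c) * M c (e.symm z.2) = 0}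
  have hG : IsCompact G := by
    refine (hS.prod (isCompact_sphere 0 1)).inter_right ?_
    have : {z : (Fin 3 → ℝ) × (Fin (Module.finrank ℝ V) → ℝ) |
        ∀ c, L c (e.symm z.2) + z.1 (r c) * M c (e.symm z.2) = 0} =
        ⋂ c, {z | L c (e.symm z.2) + z.1 (r c) * M c (e.symm z.2) = 0} := by
      ext z; simp
    rw [this]
    exact isClosed_iInter fun c => isClosed_eq
      (((hlin _).comp continuous_snd).add
        (((continuous_apply _).comp continuous_fst).mul ((hlin _).comp continuous_snd)))
      continuous_const
  have hpos : ∀ z ∈ G, 0 < B (e.symm z.2) (e.symm z.2) := by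
    rintro z ⟨⟨hz1, hz2⟩, hz3⟩
    refine (hB _).lt_of_ne fun h => ?_
    have h0 := huniq _ hz1 _ hz3 h.symm
    have : z.2 = 0 := by simpa using h0
    simp [this] at hz2
  have hbd : ∃ C : ℝ, 0 < C ∧ ∀ z ∈ G, A (e.symm z.2) (e.symm z.2) ≤
      C * B (e.symm z.2) (e.symm z.2) := by
    have hcont : ContinuousOn (fun z : (Fin 3 → ℝ) × (Fin (Module.finrank ℝ V) → ℝ) =>
        A (e.symm z.2) (e.symm z.2) / B (e.symm z.2) (e.symm z.2)) G :=
      ((hquad A).comp continuous_snd).continuousOn.div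
        ((hquad B).comp continuous_snd).continuousOn fun z hz => (hpos z hz).ne'
    obtain ⟨C, hC⟩ := (hG.image_of_continuousOn hcont).bddAbove
    refine ⟨max C 1, by positivity, fun z hz => ?_⟩
    rw [← div_le_iff₀ (hpos z hz)]
    exact (hC (mem_image_of_mem _ hz)).trans (le_max_left _ _)
  obtain ⟨C, hC, hCG⟩ := hbd
  refine ⟨C, hC, fun τ hτ x hx => ?_⟩
  rcases eq_or_ne x 0 with rfl | hx0
  · simp
  have hy : e x ≠ 0 := by simpa using hx0
  have hn : 0 < ‖e x‖ := norm_pos_iff.2 hy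
  have hsymm : e.symm (‖e x‖⁻¹ • e x) = ‖e x‖⁻¹ • x := by simp
  have := hCG (τ, ‖e x‖⁻¹ • e x) ⟨⟨hτ, by simp [norm_smul, hn.ne']⟩, fun c => by
    simp only [hsymm, map_smul, smul_eq_mul]
    linear_combination ‖e x‖⁻¹ * hx c⟩
  simp only [hsymm, map_smul, LinearMap.smul_apply, smul_eq_mul] at this
  have h2 : 0 < ‖e x‖⁻¹ * ‖e x‖⁻¹ := by positivity
  refine le_of_mul_le_mul_left ?_ h2
  linarith

/-- The bilinear form `∑ j, ∫ f j * g j` on triples of polynomials of degree at most `d`. -/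
def tripleForm (d : ℕ) : (Fin 3 → MvPolynomial.restrictTotalDegree (Fin 2) ℝ d) →ₗ[ℝ]
    (Fin 3 → MvPolynomial.restrictTotalDegree (Fin 2) ℝ d) →ₗ[ℝ] ℝ :=
  LinearMap.mk₂ ℝ (fun f g => ∑ j, triInt ((f j : P2) * (g j : P2)))
    (fun f f' g => by simp [add_mul, Finset.sum_add_distrib])
    (fun c f g => by simp [Finset.mul_sum])
    (fun f g g' => by simp [mul_add, Finset.sum_add_distrib])
    (fun c f g => by simp [Finset.mul_sum])

theorem tripleForm_apply (d : ℕ) (f g : Fin 3 → MvPolynomial.restrictTotalDegree (Fin 2) ℝ d) :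
    tripleForm d f g = ∑ j, triInt ((f j : P2) * (g j : P2)) := rfl

theorem triInt_sq_nonneg (p : P2) : 0 ≤ triInt (p * p) := by
  refine integral_nonneg fun z => ?_
  change 0 ≤ evPair z (p * p)
  rw [evPair_mul]
  exact mul_self_nonneg _

theorem hdg_reference_stability (k d : ℕ) (a b : ℝ) (ha : 0 < a) :
    ∃ C : ℝ, 0 < C ∧ ∀ τ : Fin 3 → ℝ, (∀ i, τ i ∈ Icc a b) → ∀ x y : Fin 3 → P2,
      (∀ j, (x j).totalDegree ≤ k) → (∀ j, (y j).totalDegree ≤ d) →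
      (∀ j, ∀ v : P2, v.totalDegree + 1 ≤ k → triInt ((x j - y j) * v) = 0) →
      (∀ i, ∀ μ : P2, μ.totalDegree ≤ k →
        edgeInt i (refNormal i (x - y) * μ) + τ i * edgeInt i ((x 2 - y 2) * μ) = 0) →
      ∑ j, triInt (x j * x j) ≤ C * ∑ j, triInt (y j * y j) := by
  let V := (Fin 3 → MvPolynomial.restrictTotalDegree (Fin 2) ℝ k) ×
    (Fin 3 → MvPolynomial.restrictTotalDegree (Fin 2) ℝ d)
  let ι := (Fin 3 × {v : P2 // v.totalDegree + 1 ≤ k}) ⊕ (Fin 3 × {μ : P2 // μ.totalDegree ≤ k})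
  let D : Fin 3 → V →ₗ[ℝ] P2 := fun j =>
    Submodule.subtype _ ∘ₗ LinearMap.proj j ∘ₗ LinearMap.fst ℝ _ _ -
      Submodule.subtype _ ∘ₗ LinearMap.proj j ∘ₗ LinearMap.snd ℝ _ _
  let N : Fin 3 → V →ₗ[ℝ] P2 := ![D 0 + D 1, -D 0, -D 1]
  let L : ι → V →ₗ[ℝ] ℝ := Sum.elim
    (fun c => triInt ∘ₗ LinearMap.mulRight ℝ (c.2 : P2) ∘ₗ D c.1)
    (fun c => edgeInt c.1 ∘ₗ LinearMap.mulRight ℝ (c.2 : P2) ∘ₗ N c.1)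
  let M : ι → V →ₗ[ℝ] ℝ := Sum.elim (fun _ => 0)
    (fun c => edgeInt c.1 ∘ₗ LinearMap.mulRight ℝ (c.2 : P2) ∘ₗ D 2)
  have hD : ∀ j (x : V), D j x = (x.1 j : P2) - (x.2 j : P2) := fun j x => rfl
  have hN : ∀ i (x : V), N i x = refNormal i (fun j => (x.1 j : P2) - (x.2 j : P2)) := by
    intro i x
    fin_cases i <;> rfl
  obtain ⟨C, hC, hmain⟩ := exists_uniform_quadratic_bound (V := V) (ι := ι)
    ((tripleForm k).compl₁₂ (LinearMap.fst ℝ _ _) (LinearMap.fst ℝ _ _))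
    ((tripleForm d).compl₁₂ (LinearMap.snd ℝ _ _) (LinearMap.snd ℝ _ _))
    (fun x => by
      rw [LinearMap.compl₁₂_apply, tripleForm_apply]
      exact Finset.sum_nonneg fun j _ => triInt_sq_nonneg _)
    (Set.pi univ fun _ => Icc a b) (isCompact_univ_pi fun _ => isCompact_Icc) L M
    (Sum.elim Prod.fst Prod.fst) (by
      intro τ hτ x hx hB
      have h2 : x.2 = 0 := by
        rw [LinearMap.compl₁₂_apply, tripleForm_apply] at hB
        have := (Finset.sum_eq_zero_iff_of_nonneg fun j _ => triInt_sq_nonneg _).1 hB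
        funext j
        exact Subtype.ext (triInt_sq_eq_zero _ (this j (Finset.mem_univ j)))
      have h1 : (fun j => (x.1 j : P2)) = 0 := by
        refine hdg_unisolvent k τ (fun i => ha.trans_le (hτ i (mem_univ i)).1) _
          (fun j => (MvPolynomial.mem_restrictTotalDegree _ _ _).1 (x.1 j).2) ?_ ?_
        · intro j v hv
          have := hx (Sum.inl (j, ⟨v, hv⟩))
          simpa [L, M, hD, h2] using this
        · intro i μ hμ
          have := hx (Sum.inr (i, ⟨μ, hμ⟩))
          simpa [L, M, hD, hN, h2] using this
      refine Prod.ext (funext fun j => Subtype.ext (congrFun h1 j)) h2)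
  refine ⟨C, hC, fun τ hτ x y hx hy hint hedge => ?_⟩
  have hbound := hmain τ (fun i _ => hτ i)
    (fun j => ⟨x j, (MvPolynomial.mem_restrictTotalDegree _ _ _).2 (hx j)⟩,
      fun j => ⟨y j, (MvPolynomial.mem_restrictTotalDegree _ _ _).2 (hy j)⟩) ?_
  · rw [LinearMap.compl₁₂_apply, tripleForm_apply, LinearMap.compl₁₂_apply, tripleForm_apply]
      at hbound
    exact hbound
  rintro (⟨j, v, hv⟩ | ⟨i, μ, hμ⟩)
  · simpa [L, M, hD] using hint j v hv
  · simp only [L, M, Sum.elim_inr, LinearMap.comp_apply, hN, hD, LinearMap.mulRight_apply]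
    exact hedge i μ hμ

/-! ### Affine frames of triangles -/

/-- The affine parametrization with origin `o` and directions `a`, `b`. -/
def framePt (o a b : E2) (z : ℝ × ℝ) : E2 := o + z.1 • a + z.2 • b

theorem GoodTriangle.inner_edge_eq_zero {h c₀ : ℝ} {K : Set E2} {Fc : Fin 3 → Set E2}
    {n : Fin 3 → E2} {vv : Fin 3 → E2} (hK : K = convexHull ℝ (range vv))
    (hF : ∀ i, Fc i = convexHull ℝ (vv '' {j | j ≠ i})) (hG : GoodTriangle h c₀ K Fc n)
    {i j l : Fin 3} (hj : j ≠ i) (hl : l ≠ i) : ⟪n i, vv l - vv j⟫ = 0 := by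
  have hmemF : ∀ {j}, j ≠ i → vv j ∈ Fc i := fun {j} hj => by
    rw [hF]; exact subset_convexHull ℝ _ ⟨j, hj, rfl⟩
  have hmemK : ∀ j, vv j ∈ K := fun j => by
    rw [hK]; exact subset_convexHull ℝ _ ⟨j, rfl⟩
  have h1 := (hG.2.2.2 i).2 _ (hmemF hj) _ (hmemK l)
  have h2 := (hG.2.2.2 i).2 _ (hmemF hl) _ (hmemK j)
  rw [← neg_sub, inner_neg_right] at h2
  linarith

theorem GoodTriangle.le_height {h c₀ : ℝ} {K : Set E2} {Fc : Fin 3 → Set E2}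
    {n : Fin 3 → E2} {vv : Fin 3 → E2} (hK : K = convexHull ℝ (range vv))
    (hF : ∀ i, Fc i = convexHull ℝ (vv '' {j | j ≠ i})) (hG : GoodTriangle h c₀ K Fc n)
    {i j : Fin 3} (hj : j ≠ i) : c₀ * h ≤ ⟪n i, vv j - vv i⟫ := by
  have hvF : vv j ∈ Fc i := by
    rw [hF]; exact subset_convexHull ℝ _ ⟨j, hj, rfl⟩
  have hvK : ∀ l, vv l ∈ K := fun l => by
    rw [hK]; exact subset_convexHull ℝ _ ⟨l, rfl⟩
  obtain ⟨hn1, hnK⟩ := hG.2.2.2 i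
  have hd : 0 ≤ ⟪n i, vv j - vv i⟫ := by
    have := hnK _ hvF _ (hvK i)
    rw [← neg_sub, inner_neg_right] at this
    linarith
  have hlow : ∀ y ∈ K, -⟪n i, vv j - vv i⟫ ≤ ⟪n i, y - vv j⟫ := by
    have hsub : K ⊆ {y | ⟪n i, vv i⟫ ≤ ⟪n i, y⟫} := by
      rw [hK]
      refine convexHull_min ?_ (convex_halfSpace_ge
        (f := fun y => ⟪n i, y⟫) ⟨inner_add_right _, fun c x => inner_smul_right _ _ _⟩ _)
      rintro _ ⟨l, rfl⟩
      rcases eq_or_ne l i with rfl | hl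
      · exact le_refl ⟪n l, vv l⟫
      · have := hG.inner_edge_eq_zero hK hF hj hl
        change ⟪n i, vv i⟫ ≤ ⟪n i, vv l⟫
        rw [inner_sub_right] at this hd
        linarith
    intro y hy
    have := hsub hy
    change ⟪n i, vv i⟫ ≤ ⟪n i, y⟫ at this
    rw [inner_sub_right, inner_sub_right]
    linarith
  obtain ⟨z, hz⟩ := hG.2.2.1
  refine le_of_forall_lt_imp_le_of_dense fun r hr => ?_
  rcases le_or_gt r 0 with hr0 | hr0
  · exact hr0.trans hd
  have hmem : ∀ ε : ℝ, |ε| = 1 → z + (ε * r) • n i ∈ K := fun ε hε => hz <| by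
    rw [mem_ball, dist_eq_norm, add_sub_cancel_left, norm_smul, hn1, norm_mul, Real.norm_eq_abs,
      hε, Real.norm_eq_abs, abs_of_pos hr0]
    linarith
  have hself : ⟪n i, n i⟫ = 1 := by rw [real_inner_self_eq_norm_sq, hn1, one_pow]
  have h1 := hnK _ hvF _ (hmem 1 (by simp))
  have h2 := hlow _ (hmem (-1) (by simp))
  simp only [inner_sub_right, inner_add_right, inner_smul_right, hself] at h1 h2 ⊢
  linarith

theorem GoodTriangle.norm_sub_le {h c₀ : ℝ} {K : Set E2} {Fc : Fin 3 → Set E2}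
    {n : Fin 3 → E2} (hG : GoodTriangle h c₀ K Fc n) {x y : E2} (hx : x ∈ K) (hy : y ∈ K) :
    ‖x - y‖ ≤ h := by
  obtain ⟨⟨vv, -, hK, -⟩, hdiam, -, -⟩ := hG
  rw [← dist_eq_norm]
  refine (Metric.dist_le_diam_of_mem ?_ hx hy).trans hdiam
  rw [hK]
  exact ((Set.finite_range vv).isCompact_convexHull (𝕜 := ℝ)).isBounded

theorem convexHull_range_eq_framePt_image (vv : Fin 3 → E2) :
    convexHull ℝ (range vv) =
      framePt (vv 0) (vv 1 - vv 0) (vv 2 - vv 0) '' refTri := by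
  apply Subset.antisymm
  · refine convexHull_min ?_ ?_
    · rintro _ ⟨l, rfl⟩
      fin_cases l
      · exact ⟨(0, 0), by simp [refTri], by simp [framePt]⟩
      · exact ⟨(1, 0), by simp [refTri], by simp [framePt]⟩
      · exact ⟨(0, 1), by simp [refTri], by simp [framePt]⟩
    · rintro _ ⟨x, ⟨hx1, hx2, hx3⟩, rfl⟩ _ ⟨y, ⟨hy1, hy2, hy3⟩, rfl⟩ s t hs ht hst
      refine ⟨s • x + t • y, ⟨?_, ?_, ?_⟩, ?_⟩
      · simp only [Prod.fst_add, Prod.smul_fst, smul_eq_mul]; positivity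
      · simp only [Prod.snd_add, Prod.smul_snd, smul_eq_mul]; positivity
      · simp only [Prod.fst_add, Prod.smul_fst, Prod.snd_add, Prod.smul_snd, smul_eq_mul]
        nlinarith
      · have ht' : t = 1 - s := by linarith
        subst ht'
        simp only [framePt, Prod.fst_add, Prod.smul_fst, Prod.snd_add, Prod.smul_snd, smul_eq_mul]
        module
  · rintro _ ⟨x, ⟨hx1, hx2, hx3⟩, rfl⟩
    have hmem : ∀ l, vv l ∈ convexHull ℝ (range vv) := fun l =>
      subset_convexHull ℝ _ ⟨l, rfl⟩
    have := (convex_convexHull ℝ (range vv)).sum_mem (t := Finset.univ)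
      (w := ![1 - x.1 - x.2, x.1, x.2]) (z := vv) (by
        intro i _
        fin_cases i
        · simp only [Fin.zero_eta, Matrix.cons_val_zero]; linarith
        · exact hx1
        · exact hx2) (by simp [Fin.sum_univ_three]; ring) (fun i _ => hmem i)
    convert this using 1
    simp only [framePt, Fin.sum_univ_three, Matrix.cons_val_zero, Matrix.cons_val_one,
      Matrix.cons_val]
    module

theorem edge_eq_framePt_image (vv : Fin 3 → E2) (i : Fin 3) :
    convexHull ℝ (vv '' {j | j ≠ i}) =
      (fun t => framePt (vv 0) (vv 1 - vv 0) (vv 2 - vv 0) (edgePt i t)) '' Icc 0 1 := by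
  have key : ∀ l m : Fin 3, {j | j ≠ i} = {l, m} →
      (∀ t, framePt (vv 0) (vv 1 - vv 0) (vv 2 - vv 0) (edgePt i t) =
        (1 - t) • vv l + t • vv m) →
      convexHull ℝ (vv '' {j | j ≠ i}) =
        (fun t => framePt (vv 0) (vv 1 - vv 0) (vv 2 - vv 0) (edgePt i t)) '' Icc 0 1 := by
    intro l m hlm hpt
    rw [hlm, image_pair, convexHull_pair, segment_eq_image]
    exact image_congr fun t _ => (hpt t).symm
  fin_cases i
  · refine key 1 2 (by ext j; fin_cases j <;> simp) fun t => ?_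
    simp only [framePt, edgePt, Fin.zero_eta, Matrix.cons_val_zero]; module
  · refine key 0 2 (by ext j; fin_cases j <;> simp) fun t => ?_
    simp only [framePt, edgePt, Fin.mk_one, Matrix.cons_val_one, Matrix.cons_val_zero]; module
  · refine key 0 1 (by ext j; fin_cases j <;> simp) fun t => ?_
    simp only [framePt, edgePt, Fin.reduceFinMk, Matrix.cons_val]; module

theorem edgePt_mem_refTri (i : Fin 3) {t : ℝ} (ht : t ∈ Icc 0 1) :
    edgePt i t ∈ refTri := by
  obtain ⟨h0, h1⟩ := ht
  fin_cases i
  · exact ⟨sub_nonneg.2 h1, h0, (sub_add_cancel _ _).le⟩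
  · exact ⟨le_rfl, h0, (zero_add t).trans_le h1⟩
  · exact ⟨h0, le_rfl, (add_zero t).trans_le h1⟩

/-- An affine frame for a triangle `K` together with the heights `δ` over its edges. -/
structure TriFrame (h c₀ : ℝ) (K : Set E2) (Fc : Fin 3 → Set E2) (n : Fin 3 → E2)
    (o a b : E2) (δ : Fin 3 → ℝ) : Prop where
  le_height : ∀ i, c₀ * h ≤ δ i
  height_le : ∀ i, δ i ≤ h
  norm_normal : ∀ i, ‖n i‖ = 1
  norm_fst : ‖a‖ ≤ h
  norm_snd : ‖b‖ ≤ h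
  inner_zero_fst : ⟪n 0, a⟫ = δ 0
  inner_zero_snd : ⟪n 0, b⟫ = δ 0
  inner_one_fst : ⟪n 1, a⟫ = -δ 1
  inner_one_snd : ⟪n 1, b⟫ = 0
  inner_two_fst : ⟪n 2, a⟫ = 0
  inner_two_snd : ⟪n 2, b⟫ = -δ 2
  image_eq : K = framePt o a b '' refTri
  edge_eq : ∀ i, Fc i = (fun t => framePt o a b (edgePt i t)) '' Icc 0 1

theorem GoodTriangle.exists_frame {h c₀ : ℝ} {K : Set E2} {Fc : Fin 3 → Set E2}
    {n : Fin 3 → E2} (hG : GoodTriangle h c₀ K Fc n) :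
    ∃ o a b δ, TriFrame h c₀ K Fc n o a b δ := by
  obtain ⟨vv, -, hK, hF⟩ := hG.1
  have hz : ∀ i j l, j ≠ i → l ≠ i → ⟪n i, vv l - vv j⟫ = 0 := fun i j l hj hl =>
    hG.inner_edge_eq_zero hK hF hj hl
  have hvK : ∀ l, vv l ∈ K := fun l => by
    rw [hK]; exact subset_convexHull ℝ _ ⟨l, rfl⟩
  have hsucc : ∀ i : Fin 3, i + 1 ≠ i := by decide
  refine ⟨vv 0, vv 1 - vv 0, vv 2 - vv 0, fun i => ⟪n i, vv (i + 1) - vv i⟫, ?_⟩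
  refine
    { le_height := fun i => hG.le_height hK hF (hsucc i)
      height_le := fun i => ?_
      norm_normal := fun i => (hG.2.2.2 i).1
      norm_fst := hG.norm_sub_le (hvK _) (hvK _)
      norm_snd := hG.norm_sub_le (hvK _) (hvK _)
      inner_zero_fst := rfl
      inner_zero_snd := ?_
      inner_one_fst := ?_
      inner_one_snd := hz 1 0 2 (by decide) (by decide)
      inner_two_fst := hz 2 0 1 (by decide) (by decide)
      inner_two_snd := ?_
      image_eq := hK.trans (convexHull_range_eq_framePt_image vv)
      edge_eq := fun i => (hF i).trans (edge_eq_framePt_image vv i) }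
  · refine (real_inner_le_norm _ _).trans ?_
    rw [(hG.2.2.2 i).1, one_mul]
    exact hG.norm_sub_le (hvK _) (hvK _)
  · have := hz 0 1 2 (by decide) (by decide)
    change ⟪n 0, vv 2 - vv 0⟫ = ⟪n 0, vv 1 - vv 0⟫
    simp only [inner_sub_right] at this ⊢
    linarith
  · have := hz 1 0 2 (by decide) (by decide)
    change ⟪n 1, vv 1 - vv 0⟫ = -⟪n 1, vv 2 - vv 1⟫
    simp only [inner_sub_right] at this ⊢
    linarith
  · change ⟪n 2, vv 2 - vv 0⟫ = -⟪n 2, vv 0 - vv 2⟫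
    simp only [inner_sub_right]
    ring

theorem inner_eq_sum_two (x y : E2) : ⟪x, y⟫ = x 0 * y 0 + x 1 * y 1 := by
  simp [PiLp.inner_apply, Fin.sum_univ_two, mul_comm]

theorem norm_sq_eq_sum_two (x : E2) : ‖x‖ ^ 2 = x 0 * x 0 + x 1 * x 1 := by
  rw [← real_inner_self_eq_norm_sq, inner_eq_sum_two]

namespace TriFrame

variable {h c₀ : ℝ} {K : Set E2} {Fc : Fin 3 → Set E2} {n : Fin 3 → E2} {o a b : E2}
  {δ : Fin 3 → ℝ}

theorem height_pos (hT : TriFrame h c₀ K Fc n o a b δ) (hh : 0 < h) (hc : 0 < c₀) (i : Fin 3) :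
    0 < δ i :=
  (mul_pos hc hh).trans_le (hT.le_height i)

theorem eq_combination (hT : TriFrame h c₀ K Fc n o a b δ) (hδ : ∀ i, 0 < δ i) (w : E2) :
    w = (-⟪n 1, w⟫ / δ 1) • a + (-⟪n 2, w⟫ / δ 2) • b := by
  set y := w - ((-⟪n 1, w⟫ / δ 1) • a + (-⟪n 2, w⟫ / δ 2) • b) with hy
  have h1 : ⟪n 1, y⟫ = 0 := by
    rw [hy, inner_sub_right, inner_add_right, inner_smul_right, inner_smul_right,
      hT.inner_one_fst, hT.inner_one_snd]
    have := (hδ 1).ne'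
    field_simp
    ring
  have h2 : ⟪n 2, y⟫ = 0 := by
    rw [hy, inner_sub_right, inner_add_right, inner_smul_right, inner_smul_right,
      hT.inner_two_fst, hT.inner_two_snd]
    have := (hδ 2).ne'
    field_simp
    ring
  have e1 := hT.inner_one_fst
  have e2 := hT.inner_one_snd
  have e3 := hT.inner_two_fst
  have e4 := hT.inner_two_snd
  rw [inner_eq_sum_two] at h1 h2 e1 e2 e3 e4
  have hdet : n 1 0 * n 2 1 - n 1 1 * n 2 0 ≠ 0 := by
    intro hdet
    have : δ 1 * δ 2 = 0 := by
      have : (n 1 0 * n 2 1 - n 1 1 * n 2 0) * (a 0 * b 1 - a 1 * b 0) = δ 1 * δ 2 := by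
        have e : (n 1 0 * n 2 1 - n 1 1 * n 2 0) * (a 0 * b 1 - a 1 * b 0) =
            (n 1 0 * a 0 + n 1 1 * a 1) * (n 2 0 * b 0 + n 2 1 * b 1) -
              (n 1 0 * b 0 + n 1 1 * b 1) * (n 2 0 * a 0 + n 2 1 * a 1) := by ring
        rw [e, e1, e2, e3, e4]
        ring
      rw [← this, hdet, zero_mul]
    exact (mul_pos (hδ 1) (hδ 2)).ne' this
  have y0 : y 0 = 0 := by
    refine (mul_eq_zero.1 (?_ : (n 1 0 * n 2 1 - n 1 1 * n 2 0) * y 0 = 0)).resolve_left hdet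
    linear_combination n 2 1 * h1 - n 1 1 * h2
  have y1 : y 1 = 0 := by
    refine (mul_eq_zero.1 (?_ : (n 1 0 * n 2 1 - n 1 1 * n 2 0) * y 1 = 0)).resolve_left hdet
    linear_combination n 1 0 * h2 - n 2 0 * h1
  have : y = 0 := by
    ext i
    fin_cases i
    · exact y0
    · exact y1
  exact sub_eq_zero.1 this

/-- The frame coordinates of a point. -/
def coord (n : Fin 3 → E2) (o : E2) (δ : Fin 3 → ℝ) (x : E2) : ℝ × ℝ :=
  (-⟪n 1, x - o⟫ / δ 1, -⟪n 2, x - o⟫ / δ 2)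

theorem coord_framePt (hT : TriFrame h c₀ K Fc n o a b δ) (hδ : ∀ i, 0 < δ i) (z : ℝ × ℝ) :
    coord n o δ (framePt o a b z) = z := by
  have h1 := (hδ 1).ne'
  have h2 := (hδ 2).ne'
  have e : framePt o a b z - o = z.1 • a + z.2 • b := by rw [framePt]; abel
  ext
  · simp only [coord, e, inner_add_right, inner_smul_right, hT.inner_one_fst, hT.inner_one_snd]
    field_simp
    ring
  · simp only [coord, e, inner_add_right, inner_smul_right, hT.inner_two_fst, hT.inner_two_snd]
    field_simp
    ring

theorem framePt_coord (hT : TriFrame h c₀ K Fc n o a b δ) (hδ : ∀ i, 0 < δ i) (x : E2) :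
    framePt o a b (coord n o δ x) = x := by
  have := hT.eq_combination hδ (x - o)
  rw [framePt, coord, add_assoc, ← this, add_sub_cancel]

/-- Integration over a triangle is, up to a positive factor, integration over the reference
triangle. -/
theorem exists_setIntegral_eq (hT : TriFrame h c₀ K Fc n o a b δ) (hδ : ∀ i, 0 < δ i) :
    ∃ c : ℝ, 0 < c ∧ ∀ f : E2 → ℝ,
      ∫ x in K, f x = c * ∫ z in refTri, f (framePt o a b z) := by
  let l : (ℝ × ℝ) →ₗ[ℝ] E2 :=
    (LinearMap.fst ℝ ℝ ℝ).smulRight a + (LinearMap.snd ℝ ℝ ℝ).smulRight b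
  have hl : ∀ z, framePt o a b z = o + l z := fun z => add_assoc _ _ _
  let m : E2 → ℝ × ℝ := fun x => coord n o δ (o + x)
  have hml : ∀ z, m (l z) = z := fun z => by
    change coord n o δ (o + l z) = z
    rw [← hl, hT.coord_framePt hδ]
  have hlm : ∀ x, l (m x) = x := fun x => by
    have := hT.framePt_coord hδ (o + x)
    rw [hl] at this
    exact add_left_cancel this
  let e : (ℝ × ℝ) ≃L[ℝ] E2 :=
    LinearEquiv.toContinuousLinearEquiv { l with invFun := m, left_inv := hml, right_inv := hlm }
  let Φ : (ℝ × ℝ) ≃ₜ E2 := e.toHomeomorph.trans (Homeomorph.addLeft o)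
  have hΦ : ∀ z, Φ z = framePt o a b z := fun z => (hl z).symm
  have hmap : Measure.map Φ volume = Measure.map e (volume : Measure (ℝ × ℝ)) := by
    have : Measure.map Φ volume =
        Measure.map (fun x => o + x) (Measure.map e (volume : Measure (ℝ × ℝ))) := by
      rw [Measure.map_map (measurable_const_add o) e.continuous.measurable]
      rfl
    rw [this]
    exact map_add_left_eq_self _ o
  obtain ⟨c, hc, hvol⟩ : ∃ c : NNReal, 0 < c ∧
      (volume : Measure E2) = c • Measure.map e (volume : Measure (ℝ × ℝ)) :=
    ⟨_, Measure.addHaarScalarFactor_pos_of_isAddHaarMeasure _ _,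
      Measure.isAddLeftInvariant_eq_smul _ _⟩
  refine ⟨c, NNReal.coe_pos.2 hc, fun f => ?_⟩
  have hpre : Φ ⁻¹' K = refTri := by
    rw [hT.image_eq, show framePt o a b = Φ from funext fun z => (hΦ z).symm,
      Φ.injective.preimage_image]
  rw [hvol, ← hmap, Measure.restrict_smul, integral_smul_nnreal_measure,
    Φ.measurableEmbedding.restrict_map, Φ.measurableEmbedding.integral_map, hpre]
  simp only [hΦ]
  rfl

end TriFrame

/-- Integration over a segment with respect to the one-dimensional Hausdorff measure. -/
theorem integral_hausdorffMeasure_segment (x y : E2) (hxy : x ≠ y) (f : E2 → ℝ) :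
    ∫ z, f z ∂((μH[1]).restrict ((fun t : ℝ => x + t • (y - x)) '' Icc 0 1)) =
      ‖y - x‖ * ∫ t in (0 : ℝ)..1, f (x + t • (y - x)) := by
  have hL : 0 < ‖y - x‖ := norm_pos_iff.2 (sub_ne_zero.2 hxy.symm)
  set L := ‖y - x‖ with hLdef
  let ι : ℝ → E2 := fun s => x + (s / L) • (y - x)
  have hι : Isometry ι := Isometry.of_dist_eq fun s t => by
    have e : ι s - ι t = ((s - t) / L) • (y - x) := by
      simp only [ι, sub_div]
      module
    rw [dist_eq_norm, e, norm_smul, ← hLdef, norm_div, Real.norm_eq_abs, Real.norm_eq_abs,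
      abs_of_pos hL, Real.dist_eq]
    field_simp
  have himg : (fun t : ℝ => x + t • (y - x)) '' Icc 0 1 = ι '' Icc 0 L := by
    ext z
    constructor
    · rintro ⟨t, ⟨h0, h1⟩, rfl⟩
      refine ⟨L * t, ⟨by positivity, mul_le_of_le_one_right hL.le h1⟩, ?_⟩
      simp only [ι, mul_div_cancel_left₀ t hL.ne']
    · rintro ⟨s, ⟨h0, h1⟩, rfl⟩
      exact ⟨s / L, ⟨by positivity, (div_le_one hL).2 h1⟩, rfl⟩
  have hemb : MeasurableEmbedding ι := hι.isClosedEmbedding.measurableEmbedding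
  have hmeas : (μH[1] : Measure E2).restrict (ι '' Icc 0 L) =
      Measure.map ι (volume.restrict (Icc 0 L)) := by
    have h1 := hι.map_hausdorffMeasure (d := 1) (Or.inl zero_le_one)
    rw [hausdorffMeasure_real] at h1
    have h2 := hemb.restrict_map volume (ι '' Icc 0 L)
    rw [h1, hι.injective.preimage_image, Measure.restrict_restrict_of_subset
      (image_subset_range _ _)] at h2
    exact h2
  rw [himg, hmeas, hemb.integral_map, integral_Icc_eq_integral_Ioc,
    ← intervalIntegral.integral_of_le hL.le]
  have := intervalIntegral.integral_comp_mul_left (a := 0) (b := 1)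
    (fun s => f (ι s)) hL.ne'
  rw [mul_zero, mul_one, smul_eq_mul] at this
  have h2 : ∀ t, ι (L * t) = x + t • (y - x) := fun t => by
    simp only [ι, mul_div_cancel_left₀ t hL.ne']
  simp only [h2] at this
  rw [this]
  field_simp

theorem TriFrame.exists_edge_integral_eq {h c₀ : ℝ} {K : Set E2} {Fc : Fin 3 → Set E2}
    {n : Fin 3 → E2} {o a b : E2} {δ : Fin 3 → ℝ} (hT : TriFrame h c₀ K Fc n o a b δ)
    (hδ : ∀ i, 0 < δ i) (i : Fin 3) :
    ∃ c : ℝ, 0 < c ∧ ∀ f : E2 → ℝ, ∫ x, f x ∂((μH[1]).restrict (Fc i)) =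
      c * ∫ t in (0 : ℝ)..1, f (framePt o a b (edgePt i t)) := by
  have key : ∀ x y : E2, x ≠ y →
      (∀ t : ℝ, framePt o a b (edgePt i t) = x + t • (y - x)) →
      ∃ c : ℝ, 0 < c ∧ ∀ f : E2 → ℝ, ∫ x, f x ∂((μH[1]).restrict (Fc i)) =
      c * ∫ t in (0 : ℝ)..1, f (framePt o a b (edgePt i t)) := by
    intro x y hxy hpt
    refine ⟨‖y - x‖, norm_pos_iff.2 (sub_ne_zero.2 hxy.symm), fun f => ?_⟩
    rw [hT.edge_eq i]
    simp only [hpt]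
    exact integral_hausdorffMeasure_segment x y hxy f
  have ha : ⟪n 1, a⟫ ≠ 0 := by rw [hT.inner_one_fst]; exact neg_ne_zero.2 (hδ 1).ne'
  have hb : ⟪n 2, b⟫ ≠ 0 := by rw [hT.inner_two_snd]; exact neg_ne_zero.2 (hδ 2).ne'
  fin_cases i
  · refine key (o + a) (o + b) (fun hab => ha ?_) fun t => ?_
    · rw [add_left_cancel hab, hT.inner_one_snd]
    · simp only [framePt, edgePt, Fin.zero_eta, Matrix.cons_val_zero]; module
  · refine key o (o + b) (fun hab => hb ?_) fun t => ?_
    · rw [left_eq_add.1 hab, inner_zero_right]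
    · simp only [framePt, edgePt, Fin.mk_one, Matrix.cons_val_one, Matrix.cons_val_zero]; module
  · refine key o (o + a) (fun hab => ha ?_) fun t => ?_
    · rw [left_eq_add.1 hab, inner_zero_right]
    · simp only [framePt, edgePt, Fin.reduceFinMk, Matrix.cons_val]; module

/-! ### Polynomials in frame coordinates -/

/-- The polynomial `u + v X₀ + w X₁`. -/
def affinePoly (u v w : ℝ) : P2 :=
  MvPolynomial.C u + MvPolynomial.C v * MvPolynomial.X 0 + MvPolynomial.C w * MvPolynomial.X 1

theorem totalDegree_affinePoly (u v w : ℝ) : (affinePoly u v w).totalDegree ≤ 1 := by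
  have hC : ∀ c : ℝ, ∀ i : Fin 2,
      (MvPolynomial.C c * MvPolynomial.X i : P2).totalDegree ≤ 1 := fun c i =>
    (MvPolynomial.totalDegree_mul _ _).trans (by simp [MvPolynomial.totalDegree_X])
  refine (MvPolynomial.totalDegree_add _ _).trans (max_le ?_ (hC w 1))
  exact (MvPolynomial.totalDegree_add _ _).trans (max_le (by simp) (hC v 0))

theorem eval_affinePoly (u v w : ℝ) (x : Fin 2 → ℝ) :
    MvPolynomial.eval x (affinePoly u v w) = u + v * x 0 + w * x 1 := by
  simp [affinePoly]

theorem eval_bind₁ (x : Fin 2 → ℝ) (g : Fin 2 → P2) (p : P2) :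
    MvPolynomial.eval x (MvPolynomial.bind₁ g p) =
      MvPolynomial.eval (fun i => MvPolynomial.eval x (g i)) p :=
  MvPolynomial.eval₂Hom_bind₁ (RingHom.id ℝ) x g p

theorem IsPolyOn.exists_pullback {d : ℕ} {S : Set E2} {f : E2 → ℝ} (hf : IsPolyOn d S f)
    (o a b : E2) : ∃ P : P2, P.totalDegree ≤ d ∧
      ∀ z, framePt o a b z ∈ S → f (framePt o a b z) = evPair z P := by
  obtain ⟨P, hP, hfP⟩ := hf
  refine ⟨MvPolynomial.bind₁ (fun i => affinePoly (o i) (a i) (b i)) P,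
    (totalDegree_bind₁_le _ (fun i => totalDegree_affinePoly _ _ _) P).trans hP, fun z hz => ?_⟩
  rw [hfP _ hz, evPair, eval_bind₁]
  congr 1
  simp only [eval_affinePoly, framePt, PiLp.add_apply, PiLp.smul_apply, smul_eq_mul,
    Matrix.cons_val_zero, Matrix.cons_val_one, mul_comm]

theorem TriFrame.isPolyOn_evPair_coord {d : ℕ} {v : P2} (hv : v.totalDegree ≤ d)
    (n : Fin 3 → E2) (o : E2) (δ : Fin 3 → ℝ) (S : Set E2) :
    IsPolyOn d S fun x => evPair (TriFrame.coord n o δ x) v := by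
  have haff : ∀ (ν x : E2) (c : ℝ), -⟪ν, x - o⟫ / c =
      MvPolynomial.eval (fun i => x i) (affinePoly (⟪ν, o⟫ / c) (-ν 0 / c) (-ν 1 / c)) := by
    intro ν x c
    rw [eval_affinePoly, inner_sub_right, inner_eq_sum_two ν x]
    ring
  refine ⟨MvPolynomial.bind₁ ![affinePoly (⟪n 1, o⟫ / δ 1) (-n 1 0 / δ 1) (-n 1 1 / δ 1),
      affinePoly (⟪n 2, o⟫ / δ 2) (-n 2 0 / δ 2) (-n 2 1 / δ 2)] v,
    (totalDegree_bind₁_le _ (fun i => ?_) v).trans hv, fun x _ => ?_⟩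
  · fin_cases i
    · exact totalDegree_affinePoly _ _ _
    · exact totalDegree_affinePoly _ _ _
  · simp only [evPair, eval_bind₁]
    congr 1
    congr 1
    ext i
    fin_cases i
    · exact haff _ _ _
    · exact haff _ _ _

namespace IsPolyOn

variable {d e : ℕ} {S : Set E2} {f g : E2 → ℝ}

theorem add (hf : IsPolyOn d S f) (hg : IsPolyOn d S g) : IsPolyOn d S fun x => f x + g x := by
  obtain ⟨P, hP, h⟩ := hf
  obtain ⟨Q, hQ, h'⟩ := hg
  refine ⟨P + Q, (MvPolynomial.totalDegree_add _ _).trans (max_le hP hQ), fun x hx => ?_⟩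
  simp only [map_add, h x hx, h' x hx]

theorem mul (hf : IsPolyOn d S f) (hg : IsPolyOn e S g) :
    IsPolyOn (d + e) S fun x => f x * g x := by
  obtain ⟨P, hP, h⟩ := hf
  obtain ⟨Q, hQ, h'⟩ := hg
  refine ⟨P * Q, (MvPolynomial.totalDegree_mul _ _).trans (add_le_add hP hQ), fun x hx => ?_⟩
  simp only [map_mul, h x hx, h' x hx]

theorem const (c : ℝ) : IsPolyOn d S fun _ => c :=
  ⟨MvPolynomial.C c, by simp, fun x _ => by simp⟩

theorem const_mul (c : ℝ) (hf : IsPolyOn d S f) : IsPolyOn d S fun x => c * f x := by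
  simpa using (const (d := 0) c).mul hf

theorem sub (hf : IsPolyOn d S f) (hg : IsPolyOn d S g) : IsPolyOn d S fun x => f x - g x := by
  have := hf.add (hg.const_mul (-1))
  simpa [sub_eq_add_neg] using this

theorem continuousOn (hf : IsPolyOn d S f) : ContinuousOn f S := by
  obtain ⟨P, -, h⟩ := hf
  refine ContinuousOn.congr (Continuous.continuousOn ?_) h
  exact (MvPolynomial.continuous_eval P).comp
    (continuous_pi fun i => PiLp.continuous_apply 2 (fun _ : Fin 2 => ℝ) i)

theorem coord_sub (c : ℝ) (i : Fin 2) : IsPolyOn 1 S fun x => x i - c := by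
  have hi : IsPolyOn 1 S fun x => x i :=
    ⟨MvPolynomial.X i, (MvPolynomial.totalDegree_X _).le, fun x _ => by simp⟩
  exact hi.sub (const c)

end IsPolyOn

namespace IsVPolyOn

variable {d e : ℕ} {S : Set E2} {f g : E2 → E2} {s : E2 → ℝ}

theorem continuousOn (hf : IsVPolyOn d S f) : ContinuousOn f S := by
  have h : ContinuousOn (fun x i => f x i) S := continuousOn_pi.2 fun i => (hf i).continuousOn
  exact (PiLp.continuous_toLp 2 (fun _ : Fin 2 => ℝ)).comp_continuousOn h

theorem sub (hf : IsVPolyOn d S f) (hg : IsVPolyOn d S g) : IsVPolyOn d S fun x => f x - g x :=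
  fun i => (hf i).sub (hg i)

theorem smul (hs : IsPolyOn d S s) (hf : IsVPolyOn e S f) :
    IsVPolyOn (d + e) S fun x => s x • f x :=
  fun i => hs.mul (hf i)

theorem const_smul (c : ℝ) (hf : IsVPolyOn d S f) : IsVPolyOn d S fun x => c • f x :=
  fun i => (hf i).const_mul c

theorem smul_const (hs : IsPolyOn d S s) (w : E2) : IsVPolyOn d S fun x => s x • w :=
  fun i => by
    have := (hs.const_mul (w i))
    simpa [mul_comm] using this

end IsVPolyOn

/-! ### Stability of the HDG projection on a triangle -/

/-- The component of the polynomial vector field `P` in the direction `ν`, scaled by `c`. -/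
def componentPoly (c : ℝ) (ν : E2) (P : Fin 2 → P2) : P2 :=
  c • (ν 0 • P 0 + ν 1 • P 1)

theorem totalDegree_componentPoly {d : ℕ} (c : ℝ) (ν : E2) {P : Fin 2 → P2}
    (hP : ∀ i, (P i).totalDegree ≤ d) : (componentPoly c ν P).totalDegree ≤ d :=
  (MvPolynomial.totalDegree_smul_le _ _).trans <|
    (MvPolynomial.totalDegree_add _ _).trans <|
      max_le ((MvPolynomial.totalDegree_smul_le _ _).trans (hP 0))
        ((MvPolynomial.totalDegree_smul_le _ _).trans (hP 1))

theorem evPair_componentPoly (c : ℝ) (ν : E2) {P : Fin 2 → P2} {z : ℝ × ℝ} {w : E2}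
    (hw : ∀ i, w i = evPair z (P i)) : evPair z (componentPoly c ν P) = c * ⟪ν, w⟫ := by
  rw [componentPoly, inner_eq_sum_two, evPair_smul, evPair_add, evPair_smul, evPair_smul, hw, hw]

theorem triInt_mono {p q : P2} (h : ∀ z ∈ refTri, evPair z p ≤ evPair z q) :
    triInt p ≤ triInt q :=
  setIntegral_mono_on (integrableOn_evPair p) (integrableOn_evPair q) measurableSet_refTri h

/-- The reference components of a polynomial pair on a triangle. -/
def refTriple (h : ℝ) (n : Fin 3 → E2) (δ : Fin 3 → ℝ) (P : Fin 2 → P2) (S : P2) :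
    Fin 3 → P2 :=
  ![componentPoly (-(h / δ 1)) (n 1) P, componentPoly (-(h / δ 2)) (n 2) P, S]

theorem totalDegree_refTriple {d : ℕ} (h : ℝ) (n : Fin 3 → E2) (δ : Fin 3 → ℝ)
    {P : Fin 2 → P2} {S : P2} (hP : ∀ i, (P i).totalDegree ≤ d) (hS : S.totalDegree ≤ d)
    (j : Fin 3) : (refTriple h n δ P S j).totalDegree ≤ d := by
  fin_cases j
  · exact totalDegree_componentPoly _ _ hP
  · exact totalDegree_componentPoly _ _ hP
  · exact hS

namespace TriFrame

variable {h c₀ : ℝ} {K : Set E2} {Fc : Fin 3 → Set E2} {n : Fin 3 → E2} {o a b : E2}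
  {δ : Fin 3 → ℝ}

theorem framePt_mem (hT : TriFrame h c₀ K Fc n o a b δ) {z : ℝ × ℝ} (hz : z ∈ refTri) :
    framePt o a b z ∈ K := by
  rw [hT.image_eq]; exact ⟨z, hz, rfl⟩

theorem evPair_refNormal_refTriple (hT : TriFrame h c₀ K Fc n o a b δ) (hδ : ∀ i, 0 < δ i)
    {P : Fin 2 → P2} {z : ℝ × ℝ} {w : E2} (hw : ∀ i, w i = evPair z (P i)) (S : P2)
    (i : Fin 3) :
    evPair z (refNormal i (refTriple h n δ P S)) = h / δ i * ⟪n i, w⟫ := by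
  have h0 : evPair z (refTriple h n δ P S 0) = -(h / δ 1) * ⟪n 1, w⟫ :=
    evPair_componentPoly _ _ hw
  have h1 : evPair z (refTriple h n δ P S 1) = -(h / δ 2) * ⟪n 2, w⟫ :=
    evPair_componentPoly _ _ hw
  have hδ0 := (hδ 0).ne'
  have hδ1 := (hδ 1).ne'
  have hδ2 := (hδ 2).ne'
  fin_cases i
  · change evPair z (refTriple h n δ P S 0 + refTriple h n δ P S 1) = h / δ 0 * ⟪n 0, w⟫
    have e : ⟪n 0, w⟫ = -⟪n 1, w⟫ / δ 1 * δ 0 + -⟪n 2, w⟫ / δ 2 * δ 0 := by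
      conv_lhs => rw [hT.eq_combination hδ w]
      rw [inner_add_right, inner_smul_right, inner_smul_right, hT.inner_zero_fst,
        hT.inner_zero_snd]
    rw [evPair_add, h0, h1, e]
    field_simp
  · change evPair z (-refTriple h n δ P S 0) = h / δ 1 * ⟪n 1, w⟫
    rw [evPair_neg, h0]
    ring
  · change evPair z (-refTriple h n δ P S 1) = h / δ 2 * ⟪n 2, w⟫
    rw [evPair_neg, h1]
    ring

theorem norm_sq_le (hT : TriFrame h c₀ K Fc n o a b δ) (hh : 0 < h) (hδ : ∀ i, 0 < δ i)
    (w : E2) : ‖w‖ ^ 2 ≤ 2 * ((-(h / δ 1) * ⟪n 1, w⟫) ^ 2 + (-(h / δ 2) * ⟪n 2, w⟫) ^ 2) := by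
  have hle : ∀ (c : ℝ) (v : E2), ‖v‖ ≤ h → ‖(c / h) • v‖ ≤ |c| := fun c v hv => by
    rw [norm_smul, norm_div, Real.norm_eq_abs, Real.norm_eq_abs, abs_of_pos hh,
      div_mul_eq_mul_div, div_le_iff₀ hh]
    exact mul_le_mul_of_nonneg_left hv (abs_nonneg _)
  have e : ∀ i, -⟪n i, w⟫ / δ i = -(h / δ i) * ⟪n i, w⟫ / h := fun i => by
    have := (hδ i).ne'
    field_simp
  have hw := hT.eq_combination hδ w
  rw [e, e] at hw
  have : ‖w‖ ≤ |-(h / δ 1) * ⟪n 1, w⟫| + |-(h / δ 2) * ⟪n 2, w⟫| := by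
    conv_lhs => rw [hw]
    exact (norm_add_le _ _).trans (add_le_add (hle _ _ hT.norm_fst) (hle _ _ hT.norm_snd))
  rw [← sq_abs (-(h / δ 1) * ⟪n 1, w⟫), ← sq_abs (-(h / δ 2) * ⟪n 2, w⟫)]
  nlinarith [norm_nonneg w, sq_nonneg (|-(h / δ 1) * ⟪n 1, w⟫| - |-(h / δ 2) * ⟪n 2, w⟫|)]

theorem component_sq_le (hT : TriFrame h c₀ K Fc n o a b δ) (hh : 0 < h) (hc : 0 < c₀)
    (w : E2) (i : Fin 3) : (-(h / δ i) * ⟪n i, w⟫) ^ 2 ≤ c₀⁻¹ ^ 2 * ‖w‖ ^ 2 := by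
  have hδ := hT.height_pos hh hc i
  have h1 : h / δ i ≤ c₀⁻¹ := by
    rw [div_le_iff₀ hδ, ← div_eq_inv_mul, le_div_iff₀ hc, mul_comm]
    exact hT.le_height i
  have h2 : |⟪n i, w⟫| ≤ ‖w‖ := by
    simpa [hT.norm_normal i] using abs_real_inner_le_norm (n i) w
  rw [← mul_pow, ← sq_abs, abs_mul, abs_neg, abs_of_pos (div_pos hh hδ)]
  gcongr

theorem refTriple_interior (hT : TriFrame h c₀ K Fc n o a b δ) (hδ : ∀ i, 0 < δ i)
    {k : ℕ} {τ : Fin 3 → ℝ} {q p : E2 → E2} {u s : E2 → ℝ}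
    (hsys : ProjSys2 k K Fc n τ q u p s) {P Q : Fin 2 → P2} {S U : P2}
    (hP : ∀ z ∈ refTri, ∀ i, p (framePt o a b z) i = evPair z (P i))
    (hQ : ∀ z ∈ refTri, ∀ i, q (framePt o a b z) i = evPair z (Q i))
    (hS : ∀ z ∈ refTri, s (framePt o a b z) = evPair z S)
    (hU : ∀ z ∈ refTri, u (framePt o a b z) = evPair z U)
    (j : Fin 3) {v : P2} (hv : v.totalDegree + 1 ≤ k) :
    triInt ((refTriple h n δ P S j - refTriple h n δ Q U j) * v) = 0 := by
  have hk : 1 ≤ k := by omega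
  have hv' : v.totalDegree ≤ k - 1 := by omega
  obtain ⟨c, hc, hint⟩ := hT.exists_setIntegral_eq hδ
  have htest := isPolyOn_evPair_coord hv' n o δ K
  obtain ⟨-, -, htv, hts, -⟩ := hsys
  have hvec : ∀ i : Fin 3,
      triInt ((componentPoly (-(h / δ i)) (n i) P - componentPoly (-(h / δ i)) (n i) Q) * v) =
        0 := by
    intro i
    have h0 := htv hk _ (IsVPolyOn.smul_const htest (n i))
    rw [hint] at h0
    have h1 := (mul_eq_zero.1 h0).resolve_left hc.ne'
    have h2 : triInt
        ((componentPoly (-(h / δ i)) (n i) P - componentPoly (-(h / δ i)) (n i) Q) * v) =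
        ∫ z in refTri, -(h / δ i) * ⟪p (framePt o a b z) - q (framePt o a b z),
          evPair (coord n o δ (framePt o a b z)) v • n i⟫ := by
      refine setIntegral_congr_fun measurableSet_refTri fun z hz => ?_
      rw [evPair_mul, evPair_sub, evPair_componentPoly _ _ (hP z hz),
        evPair_componentPoly _ _ (hQ z hz), hT.coord_framePt hδ, inner_smul_right,
        real_inner_comm (n i), inner_sub_right]
      ring
    rw [h2, integral_const_mul, h1, mul_zero]
  fin_cases j
  · exact hvec 1
  · exact hvec 2
  · have h0 := hts hk _ htest
    rw [hint] at h0
    have h1 := (mul_eq_zero.1 h0).resolve_left hc.ne'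
    rw [← h1]
    refine setIntegral_congr_fun measurableSet_refTri fun z hz => ?_
    change evPair z ((S - U) * v) = _
    rw [evPair_mul, evPair_sub, hT.coord_framePt hδ, hS z hz, hU z hz]

theorem refTriple_edge (hT : TriFrame h c₀ K Fc n o a b δ) (hδ : ∀ i, 0 < δ i)
    {k : ℕ} {τ : Fin 3 → ℝ} {q p : E2 → E2} {u s : E2 → ℝ}
    (hsys : ProjSys2 k K Fc n τ q u p s) {P Q : Fin 2 → P2} {S U : P2}
    (hP : ∀ z ∈ refTri, ∀ i, p (framePt o a b z) i = evPair z (P i))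
    (hQ : ∀ z ∈ refTri, ∀ i, q (framePt o a b z) i = evPair z (Q i))
    (hS : ∀ z ∈ refTri, s (framePt o a b z) = evPair z S)
    (hU : ∀ z ∈ refTri, u (framePt o a b z) = evPair z U)
    (i : Fin 3) {μ : P2} (hμ : μ.totalDegree ≤ k) :
    edgeInt i (refNormal i (refTriple h n δ P S - refTriple h n δ Q U) * μ) +
      τ i * (h / δ i) *
        edgeInt i ((refTriple h n δ P S 2 - refTriple h n δ Q U 2) * μ) = 0 := by
  obtain ⟨c, hc, hint⟩ := hT.exists_edge_integral_eq hδ i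
  have h0 := hsys.2.2.2.2 i _ (isPolyOn_evPair_coord hμ n o δ (Fc i))
  rw [hint] at h0
  have h1 := (mul_eq_zero.1 h0).resolve_left hc.ne'
  rw [← smul_eq_mul (τ i * (h / δ i)), ← map_smul, ← map_add]
  have h2 : edgeInt i (refNormal i (refTriple h n δ P S - refTriple h n δ Q U) * μ +
      (τ i * (h / δ i)) • ((refTriple h n δ P S 2 - refTriple h n δ Q U 2) * μ)) =
      ∫ t in (0 : ℝ)..1, h / δ i * ((⟪p (framePt o a b (edgePt i t)) -
        q (framePt o a b (edgePt i t)), n i⟫ + τ i * (s (framePt o a b (edgePt i t)) -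
          u (framePt o a b (edgePt i t)))) *
            evPair (coord n o δ (framePt o a b (edgePt i t))) μ) := by
    refine intervalIntegral.integral_congr fun t ht => ?_
    rw [uIcc_of_le zero_le_one] at ht
    have hz := edgePt_mem_refTri i ht
    change evPair (edgePt i t) (_ + (τ i * (h / δ i)) • ((S - U) * μ)) = _
    rw [refNormal_sub, evPair_add, evPair_mul, evPair_sub,
      hT.evPair_refNormal_refTriple hδ (hP _ hz), hT.evPair_refNormal_refTriple hδ (hQ _ hz),
      evPair_smul, evPair_mul, evPair_sub, hT.coord_framePt hδ, ← hS _ hz, ← hU _ hz,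
      real_inner_comm (n i), inner_sub_right]
    ring
  rw [h2, intervalIntegral.integral_const_mul, h1, mul_zero]

end TriFrame

/-- The first component of the HDG projection of polynomial data is `L²` stable, uniformly over
shape regular triangles. -/
theorem exists_hdg_stability (k d : ℕ) {c₀ τ₀ τ₁ : ℝ} (hc₀ : 0 < c₀) (hτ₀ : 0 < τ₀) :
    ∃ C : ℝ, 0 < C ∧ ∀ (h : ℝ), 0 < h → ∀ (K : Set E2) (Fc : Fin 3 → Set E2) (n : Fin 3 → E2),
      GoodTriangle h c₀ K Fc n → ∀ τ : Fin 3 → ℝ, (∀ i, τ₀ ≤ τ i ∧ τ i ≤ τ₁) →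
      ∀ (q p : E2 → E2) (u s : E2 → ℝ), IsVPolyOn d K q → IsPolyOn d K u →
        ProjSys2 k K Fc n τ q u p s →
        ∫ x in K, ‖p x‖ ^ 2 ≤ C * ((∫ x in K, ‖q x‖ ^ 2) + ∫ x in K, u x ^ 2) := by
  obtain ⟨C, hC, H⟩ := hdg_reference_stability k d τ₀ (τ₁ / c₀) hτ₀
  refine ⟨2 * C * (2 * c₀⁻¹ ^ 2 + 1), by positivity, ?_⟩
  intro h hh K Fc n hG τ hτ q p u s hq hu hsys
  obtain ⟨o, a, b, δ, hT⟩ := hG.exists_frame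
  have hδ := hT.height_pos hh hc₀
  choose Q hQd hQ using fun i => (hq i).exists_pullback o a b
  choose P hPd hP using fun i => (hsys.1 i).exists_pullback o a b
  obtain ⟨U, hUd, hU⟩ := hu.exists_pullback o a b
  obtain ⟨S, hSd, hS⟩ := hsys.2.1.exists_pullback o a b
  have hP' : ∀ z ∈ refTri, ∀ i, p (framePt o a b z) i = evPair z (P i) :=
    fun z hz i => hP i z (hT.framePt_mem hz)
  have hQ' : ∀ z ∈ refTri, ∀ i, q (framePt o a b z) i = evPair z (Q i) :=
    fun z hz i => hQ i z (hT.framePt_mem hz)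
  have hS' : ∀ z ∈ refTri, s (framePt o a b z) = evPair z S :=
    fun z hz => hS z (hT.framePt_mem hz)
  have hU' : ∀ z ∈ refTri, u (framePt o a b z) = evPair z U :=
    fun z hz => hU z (hT.framePt_mem hz)
  have hratio : ∀ i, τ i * (h / δ i) ∈ Icc τ₀ (τ₁ / c₀) := fun i => by
    have hτi : 0 < τ i := hτ₀.trans_le (hτ i).1
    have h1 : 1 ≤ h / δ i := (one_le_div (hδ i)).2 (hT.height_le i)
    have h2 : h / δ i ≤ 1 / c₀ := by
      rw [div_le_div_iff₀ (hδ i) hc₀, one_mul, mul_comm]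
      exact hT.le_height i
    refine ⟨(hτ i).1.trans (le_mul_of_one_le_right hτi.le h1), ?_⟩
    rw [div_eq_mul_one_div τ₁]
    exact mul_le_mul (hτ i).2 h2 (by positivity) (hτi.le.trans (hτ i).2)
  have key := H (fun i => τ i * (h / δ i)) hratio (refTriple h n δ P S) (refTriple h n δ Q U)
    (totalDegree_refTriple h n δ hPd hSd) (totalDegree_refTriple h n δ hQd hUd)
    (fun j v hv => hT.refTriple_interior hδ hsys hP' hQ' hS' hU' j hv)
    (fun i μ hμ => hT.refTriple_edge hδ hsys hP' hQ' hS' hU' i hμ)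
  obtain ⟨c, hc, hint⟩ := hT.exists_setIntegral_eq hδ
  have hsq : ∀ (r : E2 → E2) (R : Fin 2 → P2),
      (∀ z ∈ refTri, ∀ i, r (framePt o a b z) i = evPair z (R i)) → ∀ z ∈ refTri,
      ‖r (framePt o a b z)‖ ^ 2 = evPair z (R 0 * R 0 + R 1 * R 1) := fun r R hR z hz => by
    rw [norm_sq_eq_sum_two, hR z hz, hR z hz, evPair_add, evPair_mul, evPair_mul]
  have hnorm : ∀ (r : E2 → E2) (R : Fin 2 → P2),
      (∀ z ∈ refTri, ∀ i, r (framePt o a b z) i = evPair z (R i)) →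
      ∫ x in K, ‖r x‖ ^ 2 = c * triInt (R 0 * R 0 + R 1 * R 1) := fun r R hR => by
    rw [hint]
    congr 1
    exact setIntegral_congr_fun measurableSet_refTri (hsq r R hR)
  have hnormu : ∫ x in K, u x ^ 2 = c * triInt (U * U) := by
    rw [hint]
    congr 1
    refine setIntegral_congr_fun measurableSet_refTri fun z hz => ?_
    rw [hU' z hz, evPair_mul, sq]
  set x := refTriple h n δ P S
  set y := refTriple h n δ Q U
  have hx : triInt (P 0 * P 0 + P 1 * P 1) ≤ 2 * (triInt (x 0 * x 0) + triInt (x 1 * x 1)) := by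
    have e : 2 * (triInt (x 0 * x 0) + triInt (x 1 * x 1)) =
        triInt ((2 : ℝ) • (x 0 * x 0 + x 1 * x 1)) := by rw [map_smul, map_add, smul_eq_mul]
    rw [e]
    refine triInt_mono fun z hz => ?_
    rw [← hsq p P hP' z hz, evPair_smul, evPair_add, evPair_mul, evPair_mul, ← sq, ← sq]
    refine (hT.norm_sq_le hh hδ _).trans_eq ?_
    congr 3
    · exact (evPair_componentPoly _ _ (hP' z hz)).symm
    · exact (evPair_componentPoly _ _ (hP' z hz)).symm
  have hy : ∀ i : Fin 3, triInt (componentPoly (-(h / δ i)) (n i) Q *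
      componentPoly (-(h / δ i)) (n i) Q) ≤
      c₀⁻¹ ^ 2 * triInt (Q 0 * Q 0 + Q 1 * Q 1) := fun i => by
    rw [← smul_eq_mul (c₀⁻¹ ^ 2), ← map_smul]
    refine triInt_mono fun z hz => ?_
    rw [evPair_mul, evPair_componentPoly _ _ (hQ' z hz), ← sq, evPair_smul, ← hsq q Q hQ' z hz]
    exact hT.component_sq_le hh hc₀ _ i
  have hy0 : triInt (y 0 * y 0) ≤ c₀⁻¹ ^ 2 * triInt (Q 0 * Q 0 + Q 1 * Q 1) := hy 1
  have hy1 : triInt (y 1 * y 1) ≤ c₀⁻¹ ^ 2 * triInt (Q 0 * Q 0 + Q 1 * Q 1) := hy 2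
  have hy2 : triInt (y 2 * y 2) = triInt (U * U) := rfl
  rw [Fin.sum_univ_three, Fin.sum_univ_three] at key
  have hx2 := triInt_sq_nonneg (x 2)
  have hU0 := triInt_sq_nonneg U
  have hQ0 : 0 ≤ triInt (Q 0 * Q 0 + Q 1 * Q 1) := by
    rw [map_add]
    exact add_nonneg (triInt_sq_nonneg _) (triInt_sq_nonneg _)
  rw [hnorm p P hP', hnorm q Q hQ', hnormu]
  have hfin : triInt (P 0 * P 0 + P 1 * P 1) ≤ 2 * C * (2 * c₀⁻¹ ^ 2 + 1) *
      (triInt (Q 0 * Q 0 + Q 1 * Q 1) + triInt (U * U)) := by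
    have hc2 : 0 ≤ c₀⁻¹ ^ 2 := by positivity
    calc _ ≤ 2 * (triInt (x 0 * x 0) + triInt (x 1 * x 1)) := hx
      _ ≤ 2 * (C * (triInt (y 0 * y 0) + triInt (y 1 * y 1) + triInt (y 2 * y 2))) := by linarith
      _ ≤ 2 * (C * ((2 * c₀⁻¹ ^ 2 + 1) *
            (triInt (Q 0 * Q 0 + Q 1 * Q 1) + triInt (U * U)))) := by
          gcongr
          nlinarith [mul_nonneg hc2 hU0]
      _ = _ := by ring
  calc _ ≤ c * (2 * C * (2 * c₀⁻¹ ^ 2 + 1) *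
      (triInt (Q 0 * Q 0 + Q 1 * Q 1) + triInt (U * U))) := by gcongr
    _ = _ := by ring

/-! ### The weight and `L²` norms on a triangle -/

theorem sigw_sq (x₀ : E2) (h : ℝ) (x : E2) : sigw x₀ h x ^ 2 = ‖x - x₀‖ ^ 2 + h ^ 2 :=
  Real.sq_sqrt (by positivity)

theorem le_sigw (x₀ : E2) {h : ℝ} (x : E2) : h ≤ sigw x₀ h x :=
  Real.le_sqrt_of_sq_le (by nlinarith [sq_nonneg ‖x - x₀‖])

theorem sigw_le_add (x₀ : E2) {h : ℝ} (hh : 0 < h) {x y : E2} (hxy : ‖x - y‖ ≤ h) :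
    sigw x₀ h x ≤ sigw x₀ h y + h := by
  have hy : ‖y - x₀‖ ≤ sigw x₀ h y := Real.le_sqrt_of_sq_le (by nlinarith [sq_nonneg h])
  have hy0 : 0 < sigw x₀ h y := hh.trans_le (le_sigw x₀ y)
  have htri : ‖x - x₀‖ ≤ h + ‖y - x₀‖ := by
    rw [← sub_add_sub_cancel x y x₀]
    exact (norm_add_le _ _).trans (by gcongr)
  refine (Real.sqrt_le_left (by positivity)).2 ?_
  have := sigw_sq x₀ h y
  nlinarith [norm_nonneg (x - x₀), norm_nonneg (y - x₀)]

theorem sigw_le_two_mul (x₀ : E2) {h : ℝ} (hh : 0 < h) {x y : E2} (hxy : ‖x - y‖ ≤ h) :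
    sigw x₀ h x ≤ 2 * sigw x₀ h y := by
  linarith [sigw_le_add x₀ hh hxy, le_sigw x₀ (h := h) y]

theorem abs_sigw_sq_sub_le (x₀ : E2) {h : ℝ} (hh : 0 < h) {x y : E2} (hxy : ‖x - y‖ ≤ h) :
    |sigw x₀ h x ^ 2 - sigw x₀ h y ^ 2| ≤ 3 * h * sigw x₀ h y := by
  have h1 := sigw_le_add x₀ hh hxy
  have h2 := sigw_le_add x₀ hh ((norm_sub_rev y x).trans_le hxy)
  have h3 := le_sigw x₀ (h := h) x
  have h4 := le_sigw x₀ (h := h) y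
  rw [abs_le]
  constructor <;> nlinarith

theorem isPolyOn_sigw_sq_sub (x₀ : E2) (h m : ℝ) (S : Set E2) :
    IsPolyOn 2 S fun x => sigw x₀ h x ^ 2 - m := by
  have hc : ∀ i, IsPolyOn 2 S fun x => (x i - x₀ i) * (x i - x₀ i) := fun i =>
    (IsPolyOn.coord_sub _ i).mul (IsPolyOn.coord_sub _ i)
  have := ((hc 0).add (hc 1)).add (IsPolyOn.const (h ^ 2 - m))
  convert this using 2 with x
  rw [sigw_sq, norm_sq_eq_sum_two]
  simp only [PiLp.sub_apply]
  ring

theorem eLpNorm_two_restrict_eq {F : Type*} [NormedAddCommGroup F] {K : Set E2}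
    (hK : IsCompact K) {f : E2 → F} (hf : ContinuousOn f K) :
    eLpNorm f 2 (volume.restrict K) = ENNReal.ofReal (√(∫ x in K, ‖f x‖ ^ 2)) := by
  have hmem : MemLp f 2 (volume.restrict K) := by
    have : IsFiniteMeasure (volume.restrict K) := ⟨by simpa using hK.measure_lt_top⟩
    obtain ⟨B, hB⟩ := hK.exists_bound_of_continuousOn hf
    exact MemLp.of_bound (hf.aestronglyMeasurable_of_isCompact hK hK.measurableSet) B
      ((ae_restrict_iff' hK.measurableSet).2 (.of_forall hB))
  rw [hmem.eLpNorm_eq_integral_rpow_norm two_ne_zero ofNat_ne_top, Real.sqrt_eq_rpow]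
  norm_num

theorem eLpNorm_two_restrict_le_mul_add {F G H : Type*} [NormedAddCommGroup F]
    [NormedAddCommGroup G] [NormedAddCommGroup H] {K : Set E2} (hK : IsCompact K)
    {p : E2 → F} {q : E2 → G} {u : E2 → H} (hp : ContinuousOn p K) (hq : ContinuousOn q K)
    (hu : ContinuousOn u K) {C : ℝ} (hC : 0 ≤ C)
    (h : ∫ x in K, ‖p x‖ ^ 2 ≤ C * ((∫ x in K, ‖q x‖ ^ 2) + ∫ x in K, ‖u x‖ ^ 2)) :
    eLpNorm p 2 (volume.restrict K) ≤ ENNReal.ofReal (√C) *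
      (eLpNorm q 2 (volume.restrict K) + eLpNorm u 2 (volume.restrict K)) := by
  rw [eLpNorm_two_restrict_eq hK hp, eLpNorm_two_restrict_eq hK hq,
    eLpNorm_two_restrict_eq hK hu, ← ENNReal.ofReal_add (by positivity) (by positivity),
    ← ENNReal.ofReal_mul (by positivity)]
  refine ENNReal.ofReal_le_ofReal ?_
  refine (Real.sqrt_le_sqrt h).trans ?_
  rw [Real.sqrt_mul hC]
  gcongr
  have hA : 0 ≤ ∫ x in K, ‖q x‖ ^ 2 := integral_nonneg fun _ => by positivity
  have hB : 0 ≤ ∫ x in K, ‖u x‖ ^ 2 := integral_nonneg fun _ => by positivity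
  refine Real.sqrt_le_iff.2 ⟨by positivity, ?_⟩
  nlinarith [Real.sq_sqrt hA, Real.sq_sqrt hB,
    mul_nonneg (Real.sqrt_nonneg (∫ x in K, ‖q x‖ ^ 2)) (Real.sqrt_nonneg (∫ x in K, ‖u x‖ ^ 2))]

theorem eLpNorm_restrict_le_ofReal_mul {F G : Type*} [NormedAddCommGroup F]
    [NormedAddCommGroup G] {K : Set E2} (hK : MeasurableSet K) {f : E2 → F} {g : E2 → G} {c : ℝ}
    (h : ∀ x ∈ K, ‖f x‖ ≤ c * ‖g x‖) :
    eLpNorm f 2 (volume.restrict K) ≤ ENNReal.ofReal c * eLpNorm g 2 (volume.restrict K) :=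
  eLpNorm_le_mul_eLpNorm_of_ae_le_mul ((ae_restrict_iff' hK).2 (.of_forall h)) 2

/-- Subtracting an `L²` projection does not increase the `L²` norm. -/
theorem eLpNorm_sub_le_of_orthogonal {K : Set E2} (hK : IsCompact K) {f z : E2 → E2}
    (hf : ContinuousOn f K) (hz : ContinuousOn z K)
    (horth : ∫ x in K, ⟪f x - z x, z x⟫ = 0) :
    eLpNorm (fun x => f x - z x) 2 (volume.restrict K) ≤ eLpNorm f 2 (volume.restrict K) := by
  have hfz : ContinuousOn (fun x => f x - z x) K := hf.sub hz
  rw [eLpNorm_two_restrict_eq hK hf, eLpNorm_two_restrict_eq hK hfz]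
  refine ENNReal.ofReal_le_ofReal (Real.sqrt_le_sqrt ?_)
  have h1 : IntegrableOn (fun x => ‖f x - z x‖ ^ 2) K :=
    (hfz.norm.pow 2).integrableOn_compact hK
  have h2 : IntegrableOn (fun x => 2 * ⟪f x - z x, z x⟫) K :=
    (continuousOn_const.mul (hfz.inner hz)).integrableOn_compact hK
  have h3 : IntegrableOn (fun x => ‖f x‖ ^ 2) K := (hf.norm.pow 2).integrableOn_compact hK
  calc ∫ x in K, ‖f x - z x‖ ^ 2
      = ∫ x in K, (‖f x - z x‖ ^ 2 + 2 * ⟪f x - z x, z x⟫) := by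
        rw [integral_add h1 h2, integral_const_mul, horth, mul_zero, add_zero]
    _ ≤ ∫ x in K, ‖f x‖ ^ 2 := by
        refine setIntegral_mono (h1.add h2) h3 fun x => ?_
        have := norm_add_sq_real (f x - z x) (z x)
        rw [sub_add_cancel] at this
        change ‖f x - z x‖ ^ 2 + 2 * ⟪f x - z x, z x⟫ ≤ ‖f x‖ ^ 2
        nlinarith [sq_nonneg ‖z x‖]

theorem ProjSys2.sub {k : ℕ} {K : Set E2} {Fc : Fin 3 → Set E2} {n : Fin 3 → E2}
    {τ : Fin 3 → ℝ} {q p g : E2 → E2} {u s r : E2 → ℝ} (hsys : ProjSys2 k K Fc n τ q u p s)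
    (hg : IsVPolyOn k K g) (hr : IsPolyOn k K r) :
    ProjSys2 k K Fc n τ (fun x => q x - g x) (fun x => u x - r x)
      (fun x => p x - g x) (fun x => s x - r x) := by
  obtain ⟨hp, hs, h1, h2, h3⟩ := hsys
  refine ⟨hp.sub hg, hs.sub hr, ?_⟩
  simpa only [sub_sub_sub_cancel_right] using ⟨h1, h2, h3⟩

theorem GoodTriangle.isCompact {h c₀ : ℝ} {K : Set E2} {Fc : Fin 3 → Set E2}
    {n : Fin 3 → E2} (hG : GoodTriangle h c₀ K Fc n) : IsCompact K := by
  obtain ⟨⟨vv, -, hK, -⟩, -⟩ := hG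
  rw [hK]
  exact (Set.finite_range vv).isCompact_convexHull (𝕜 := ℝ)

theorem GoodTriangle.nonempty {h c₀ : ℝ} {K : Set E2} {Fc : Fin 3 → Set E2}
    {n : Fin 3 → E2} (hG : GoodTriangle h c₀ K Fc n) : K.Nonempty := by
  obtain ⟨⟨vv, -, hK, -⟩, -⟩ := hG
  exact ⟨vv 0, hK ▸ subset_convexHull ℝ _ ⟨0, rfl⟩⟩

/-- superapproximation, Lemma 3.6: for discrete `(v_h, w_h)`,
`‖σ^{−1}(σ² v_h − Π_k^o(σ² v_h))‖_{L²(K)} ≤ C h ‖v_h‖_{L²(K)}` and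
`‖σ^{−1}(σ² v_h − Π_V(σ² v_h))‖_{L²(K)} ≤ C h (‖v_h‖_{L²(K)} + ‖w_h‖_{L²(K)})`,
where `Π_V(σ² v_h)` is the first component of the HDG projection of
`(σ² v_h, −σ² w_h)`. -/
theorem stmt13_superapproximation
    (k : ℕ) (c₀ τ₀ τ₁ : ℝ) (hc₀ : 0 < c₀) (hτ₀ : 0 < τ₀) (hτ₁ : τ₀ ≤ τ₁) :
    ∃ C : ℝ, 0 < C ∧
      ∀ (h : ℝ), 0 < h → h < 1 → ∀ (x₀ : E2)
        (K : Set E2) (Fc : Fin 3 → Set E2) (n : Fin 3 → E2),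
        GoodTriangle h c₀ K Fc n →
      ∀ (τ : Fin 3 → ℝ), (∀ i, τ₀ ≤ τ i ∧ τ i ≤ τ₁) →
      ∀ (vh : E2 → E2) (wh : E2 → ℝ), IsVPolyOn k K vh → IsPolyOn k K wh →
        -- the L² projection bound
        (∀ R : E2 → E2, IsVPolyOn k K R →
          (∀ z, IsVPolyOn k K z →
            ∫ x in K, ⟪(sigw x₀ h x ^ 2 • vh x) - R x, z x⟫ = 0) →
          eLpNorm (fun x => (sigw x₀ h x)⁻¹ * ‖sigw x₀ h x ^ 2 • vh x - R x‖) 2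
              (volume.restrict K) ≤
            ENNReal.ofReal (C * h) * eLpNorm vh 2 (volume.restrict K)) ∧
        -- the HDG projection bound
        (∀ PV : E2 → E2,
          (∃ PW, ProjSys2 k K Fc n τ
            (fun x => sigw x₀ h x ^ 2 • vh x) (fun x => -(sigw x₀ h x ^ 2 * wh x)) PV PW) →
          eLpNorm (fun x => (sigw x₀ h x)⁻¹ * ‖sigw x₀ h x ^ 2 • vh x - PV x‖) 2
              (volume.restrict K) ≤
            ENNReal.ofReal (C * h) *
              (eLpNorm vh 2 (volume.restrict K) + eLpNorm wh 2 (volume.restrict K))) := by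
  obtain ⟨C, hC, H⟩ := exists_hdg_stability k (2 + k) (τ₁ := τ₁) hc₀ hτ₀
  refine ⟨6 * (1 + √C), by positivity, ?_⟩
  intro h hh _ x₀ K Fc n hG τ hτ vh wh hv hw
  have hK := hG.isCompact
  obtain ⟨y, hy⟩ := hG.nonempty
  have hdist : ∀ x ∈ K, ‖x - y‖ ≤ h := fun x hx => hG.norm_sub_le hx hy
  set m := sigw x₀ h y
  have hm0 : 0 < m := hh.trans_le (le_sigw x₀ y)
  have hweight : ∀ g : E2 → E2,
      eLpNorm (fun x => (sigw x₀ h x)⁻¹ * ‖g x‖) 2 (volume.restrict K) ≤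
        ENNReal.ofReal (2 / m) * eLpNorm g 2 (volume.restrict K) := fun g => by
    refine eLpNorm_restrict_le_ofReal_mul hK.measurableSet fun x hx => ?_
    have hx0 : 0 < sigw x₀ h x := hh.trans_le (le_sigw x₀ x)
    rw [norm_mul, norm_norm, norm_inv, Real.norm_of_nonneg hx0.le]
    gcongr
    rw [inv_le_comm₀ hx0 (by positivity), inv_div, div_le_iff₀ two_pos, mul_comm]
    exact sigw_le_two_mul x₀ hh ((norm_sub_rev y x).trans_le (hdist x hx))
  have hpoly := isPolyOn_sigw_sq_sub x₀ h (m ^ 2) K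
  have hqp : IsVPolyOn (2 + k) K fun x => (sigw x₀ h x ^ 2 - m ^ 2) • vh x :=
    IsVPolyOn.smul hpoly hv
  have hup : IsPolyOn (2 + k) K fun x => (sigw x₀ h x ^ 2 - m ^ 2) * (-1 * wh x) :=
    hpoly.mul (hw.const_mul (-1))
  have hq_le : eLpNorm (fun x => (sigw x₀ h x ^ 2 - m ^ 2) • vh x) 2 (volume.restrict K) ≤
      ENNReal.ofReal (3 * h * m) * eLpNorm vh 2 (volume.restrict K) :=
    eLpNorm_restrict_le_ofReal_mul hK.measurableSet fun x hx => by
      rw [norm_smul]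
      gcongr
      exact abs_sigw_sq_sub_le x₀ hh (hdist x hx)
  have hu_le : eLpNorm (fun x => (sigw x₀ h x ^ 2 - m ^ 2) * (-1 * wh x)) 2
      (volume.restrict K) ≤ ENNReal.ofReal (3 * h * m) * eLpNorm wh 2 (volume.restrict K) :=
    eLpNorm_restrict_le_ofReal_mul hK.measurableSet fun x hx => by
      rw [norm_mul, neg_one_mul, norm_neg]
      gcongr
      exact abs_sigw_sq_sub_le x₀ hh (hdist x hx)
  have hconst : ENNReal.ofReal (6 * h) =
      ENNReal.ofReal (2 / m) * ENNReal.ofReal (3 * h * m) := by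
    rw [← ENNReal.ofReal_mul (by positivity)]
    congr 1
    field_simp
    norm_num
  refine ⟨fun R hR horth => (hweight _).trans ?_, fun PV ⟨PW, hsys⟩ => (hweight _).trans ?_⟩
  · have hz : IsVPolyOn k K fun x => R x - m ^ 2 • vh x := hR.sub (hv.const_smul _)
    have e : ∀ x, sigw x₀ h x ^ 2 • vh x - R x =
        (sigw x₀ h x ^ 2 - m ^ 2) • vh x - (R x - m ^ 2 • vh x) := fun x => by module
    have h0 := horth _ hz
    simp only [e] at h0 ⊢
    have h1 := eLpNorm_sub_le_of_orthogonal hK hqp.continuousOn hz.continuousOn h0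
    calc _ ≤ ENNReal.ofReal (2 / m) *
          (ENNReal.ofReal (3 * h * m) * eLpNorm vh 2 (volume.restrict K)) := by
          gcongr
          exact h1.trans hq_le
      _ = ENNReal.ofReal (6 * h) * eLpNorm vh 2 (volume.restrict K) := by
          rw [← mul_assoc, ← hconst]
      _ ≤ _ := by
          gcongr
          linarith [Real.sqrt_nonneg C]
  · have hsys' := hsys.sub (hv.const_smul (m ^ 2)) (hw.const_mul (-m ^ 2))
    have eq : (fun x => sigw x₀ h x ^ 2 • vh x - m ^ 2 • vh x) =
        fun x => (sigw x₀ h x ^ 2 - m ^ 2) • vh x := funext fun x => (sub_smul _ _ _).symm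
    have eu : (fun x => -(sigw x₀ h x ^ 2 * wh x) - -m ^ 2 * wh x) =
        fun x => (sigw x₀ h x ^ 2 - m ^ 2) * (-1 * wh x) := funext fun x => by ring
    rw [eq, eu] at hsys'
    have hstab := H h hh K Fc n hG τ hτ _ _ _ _ hqp hup hsys'
    have hp_le := eLpNorm_two_restrict_le_mul_add hK hsys'.1.continuousOn hqp.continuousOn
      hup.continuousOn hC.le (by simpa only [Real.norm_eq_abs, sq_abs] using hstab)
    have e : (fun x => sigw x₀ h x ^ 2 • vh x - PV x) =
        (fun x => (sigw x₀ h x ^ 2 - m ^ 2) • vh x) - fun x => PV x - m ^ 2 • vh x :=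
      funext fun x => by
        simp only [Pi.sub_apply]
        module
    have hg_le := eLpNorm_sub_le
      (hqp.continuousOn.aestronglyMeasurable_of_isCompact hK hK.measurableSet (μ := volume))
      (hsys'.1.continuousOn.aestronglyMeasurable_of_isCompact hK hK.measurableSet (μ := volume))
      one_le_two
    rw [← e] at hg_le
    set V := eLpNorm vh 2 (volume.restrict K)
    set W := eLpNorm wh 2 (volume.restrict K)
    have hqu := add_le_add hq_le hu_le
    rw [← mul_add] at hqu
    calc _ ≤ ENNReal.ofReal (2 / m) * (ENNReal.ofReal (3 * h * m) * (V + W) +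
          ENNReal.ofReal (√C) * (ENNReal.ofReal (3 * h * m) * (V + W))) := by
          gcongr
          refine hg_le.trans (add_le_add (le_self_add.trans hqu) (hp_le.trans ?_))
          gcongr
      _ = ENNReal.ofReal (6 * (1 + √C) * h) * (V + W) := by
          have hC' : ENNReal.ofReal (6 * (1 + √C) * h) = (1 + ENNReal.ofReal (√C)) *
              (ENNReal.ofReal (2 / m) * ENNReal.ofReal (3 * h * m)) := by
            rw [← hconst, ← ENNReal.ofReal_one,
              ← ENNReal.ofReal_add zero_le_one (Real.sqrt_nonneg C),
              ← ENNReal.ofReal_mul (by positivity)]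
            congr 1
            ring
          rw [hC']
          ring
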